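/- Let N ≥ 2 be an integer and y₁ < y₂ < ⋯ < y_{2N} be real numbers, and fix t, s with y₁ < t < s < y₂. Then there exists exactly one holomorphic function h̃ on the open upper half-plane ℍ satisfying: (1) Re h̃ extends continuously to (−∞, y₁) ∪ (y_{2N}, +∞) with boundary value 0; (2) there exists a constant c ∈ ℝ such that for every 1 ≤ i ≤ N−1, Re h̃ extends continuously to (y_{2i}, y_{2i+1}) with boundary value identically c; (3) for each 2 ≤ i ≤ N, Im h̃ extends continuously to (y_{2i−1}, y_{2i}) with a constant boundary value; (4) Im h̃ extends continuously with boundary value 0 on (y_{2N−1}, y_{2N}) ∪ (y₁, t) ∪ (s, y₂) and with boundary value 1 on (t, s); (5) Im h̃ is bounded on ℍ and extends continuously to cl(ℍ) ∖ {t, s}. -/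

import Mathlib

open Set Metric Filter Complex Topology

noncomputable section

/-- The open upper half-plane in `ℂ`. -/
def UHP : Set ℂ := {z | 0 < z.im}

/-- The mixed boundary-value problem for the holomorphic observable `h(·, t, s; y₁,…,y_{2N})`,
with the Dirichlet-1 window `(t,s)` contained in `(y_{2N-1}, y_{2N})`.
Boundary values are understood as limits within the upper half-plane. -/
def SolvesBVP (N : ℕ) (y : ℕ → ℝ) (t s : ℝ) (h : ℂ → ℂ) : Prop :=
  -- holomorphic on ℍ
  DifferentiableOn ℂ h UHP ∧
  -- (1) Re h = 0 on (-∞, y₁) ∪ (y_{2N}, +∞)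
  (∀ p : ℝ, (p < y 1 ∨ y (2 * N) < p) →
    Tendsto (fun z => (h z).re) (𝓝[UHP] (p : ℂ)) (𝓝 0)) ∧
  -- (2) Re h equals one common constant on all (y_{2i}, y_{2i+1}), 1 ≤ i ≤ N-1
  (∃ c : ℝ, ∀ i : ℕ, 1 ≤ i → i ≤ N - 1 → ∀ p ∈ Set.Ioo (y (2 * i)) (y (2 * i + 1)),
    Tendsto (fun z => (h z).re) (𝓝[UHP] (p : ℂ)) (𝓝 c)) ∧
  -- (3) Im h is constant on each (y_{2i-1}, y_{2i}), 1 ≤ i ≤ N-1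
  (∀ i : ℕ, 1 ≤ i → i ≤ N - 1 → ∃ c : ℝ, ∀ p ∈ Set.Ioo (y (2 * i - 1)) (y (2 * i)),
    Tendsto (fun z => (h z).im) (𝓝[UHP] (p : ℂ)) (𝓝 c)) ∧
  -- (4) Im h = 0 on (y₁,y₂) ∪ (y_{2N-1},t) ∪ (s,y_{2N}) and Im h = 1 on (t,s)
  (∀ p ∈ Set.Ioo (y 1) (y 2) ∪ Set.Ioo (y (2 * N - 1)) t ∪ Set.Ioo s (y (2 * N)),
    Tendsto (fun z => (h z).im) (𝓝[UHP] (p : ℂ)) (𝓝 0)) ∧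
  (∀ p ∈ Set.Ioo t s, Tendsto (fun z => (h z).im) (𝓝[UHP] (p : ℂ)) (𝓝 1)) ∧
  -- (5) Im h is bounded on ℍ and continuous up to cl(ℍ) \ {t, s}
  (∃ C : ℝ, ∀ z ∈ UHP, |(h z).im| ≤ C) ∧
  (∃ g : ℂ → ℝ, ContinuousOn g (closure UHP \ {(t : ℂ), (s : ℂ)}) ∧
    ∀ z ∈ UHP, g z = (h z).im)

/-- The mixed boundary-value problem for the holomorphic observable `h̃(·, t, s; y₁,…,y_{2N})`,
with the Dirichlet-1 window `(t,s)` contained in `(y₁, y₂)`. -/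
def SolvesBVP' (N : ℕ) (y : ℕ → ℝ) (t s : ℝ) (h : ℂ → ℂ) : Prop :=
  -- holomorphic on ℍ
  DifferentiableOn ℂ h UHP ∧
  -- (1) Re h̃ = 0 on (-∞, y₁) ∪ (y_{2N}, +∞)
  (∀ p : ℝ, (p < y 1 ∨ y (2 * N) < p) →
    Tendsto (fun z => (h z).re) (𝓝[UHP] (p : ℂ)) (𝓝 0)) ∧
  -- (2) Re h̃ equals one common constant on all (y_{2i}, y_{2i+1}), 1 ≤ i ≤ N-1
  (∃ c : ℝ, ∀ i : ℕ, 1 ≤ i → i ≤ N - 1 → ∀ p ∈ Set.Ioo (y (2 * i)) (y (2 * i + 1)),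
    Tendsto (fun z => (h z).re) (𝓝[UHP] (p : ℂ)) (𝓝 c)) ∧
  -- (3) Im h̃ is constant on each (y_{2i-1}, y_{2i}), 2 ≤ i ≤ N
  (∀ i : ℕ, 2 ≤ i → i ≤ N → ∃ c : ℝ, ∀ p ∈ Set.Ioo (y (2 * i - 1)) (y (2 * i)),
    Tendsto (fun z => (h z).im) (𝓝[UHP] (p : ℂ)) (𝓝 c)) ∧
  -- (4) Im h̃ = 0 on (y_{2N-1},y_{2N}) ∪ (y₁,t) ∪ (s,y₂) and Im h̃ = 1 on (t,s)
  (∀ p ∈ Set.Ioo (y (2 * N - 1)) (y (2 * N)) ∪ Set.Ioo (y 1) t ∪ Set.Ioo s (y 2),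
    Tendsto (fun z => (h z).im) (𝓝[UHP] (p : ℂ)) (𝓝 0)) ∧
  (∀ p ∈ Set.Ioo t s, Tendsto (fun z => (h z).im) (𝓝[UHP] (p : ℂ)) (𝓝 1)) ∧
  -- (5) Im h̃ is bounded on ℍ and continuous up to cl(ℍ) \ {t, s}
  (∃ C : ℝ, ∀ z ∈ UHP, |(h z).im| ≤ C) ∧
  (∃ g : ℂ → ℝ, ContinuousOn g (closure UHP \ {(t : ℂ), (s : ℂ)}) ∧
    ∀ z ∈ UHP, g z = (h z).im)

lemma mem_UHP {z : ℂ} : z ∈ UHP ↔ 0 < z.im := Iff.rfl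

lemma isOpen_UHP : IsOpen UHP := isOpen_lt continuous_const Complex.continuous_im

lemma closure_UHP : closure UHP = {z : ℂ | 0 ≤ z.im} := Complex.closure_setOfPred_lt_im 0

lemma mem_cUHP {z : ℂ} : z ∈ closure UHP ↔ 0 ≤ z.im := by rw [closure_UHP]; rfl

lemma convex_UHP : Convex ℝ UHP := convex_halfSpace_im_gt 0

lemma real_mem_cUHP (x : ℝ) : (x : ℂ) ∈ closure UHP := by rw [mem_cUHP]; simp

instance neBot_UHP (x : ℝ) : (𝓝[UHP] (x : ℂ)).NeBot :=
  mem_closure_iff_nhdsWithin_neBot.1 (real_mem_cUHP x)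

/-- A continuous function on a ball which is holomorphic off the real axis is holomorphic. -/
lemma differentiableOn_of_off_real {F : ℂ → ℂ} {c : ℂ} {r : ℝ}
    (hc : ContinuousOn F (ball c r))
    (hd : ∀ z ∈ ball c r, z.im ≠ 0 → DifferentiableAt ℂ F z) :
    DifferentiableOn ℂ F (ball c r) := by
  refine (isConservativeOn_and_continuousOn_iff_isDifferentiableOn isOpen_ball).1 ⟨?_, hc⟩
  intro z w hzw
  rw [eq_neg_iff_add_eq_zero, wedgeIntegral_add_wedgeIntegral_eq]
  have key : ∀ a b : ℂ, Rectangle a b ⊆ ball c r →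
      (∀ y ∈ Ioo (min a.im b.im) (max a.im b.im), y ≠ 0) →
      (∫ x : ℝ in a.re..b.re, F (x + a.im * I)) - (∫ x : ℝ in a.re..b.re, F (x + b.im * I)) +
      I • (∫ y : ℝ in a.im..b.im, F (re b + y * I)) -
      I • (∫ y : ℝ in a.im..b.im, F (re a + y * I)) = 0 := by
    intro a b hab h0
    refine integral_boundary_rect_eq_zero_of_continuousOn_of_differentiableOn F a b
      (hc.mono hab) ?_
    intro x hx
    refine (hd x (hab ?_) (h0 _ hx.2)).differentiableWithinAt
    exact ⟨Ioo_subset_Icc_self hx.1, Ioo_subset_Icc_self hx.2⟩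
  by_cases h0 : (0 : ℝ) ∈ Ioo (min z.im w.im) (max z.im w.im)
  · have h0' : (0 : ℝ) ∈ (uIcc z.im w.im) := Ioo_subset_Icc_self h0
    have s1 : Rectangle z (w.re : ℂ) ⊆ Rectangle z w := by
      rintro x ⟨h1, h2⟩
      refine ⟨by simpa using h1, ?_⟩
      have h2' : x.im ∈ (uIcc z.im (0:ℝ)) := by simpa using h2
      exact uIcc_subset_uIcc_left h0' h2'
    have s2 : Rectangle (z.re : ℂ) w ⊆ Rectangle z w := by
      rintro x ⟨h1, h2⟩
      refine ⟨by simpa using h1, ?_⟩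
      have h2' : x.im ∈ (uIcc (0:ℝ) w.im) := by simpa using h2
      exact uIcc_subset_uIcc_right h0' h2'
    have k1 := key z (w.re : ℂ) (s1.trans hzw) (by
      intro y hy h; subst h; simp at hy; grind)
    have k2 := key (z.re : ℂ) w (s2.trans hzw) (by
      intro y hy h; subst h; simp at hy; grind)
    have hIntg : ∀ q : ℝ, q ∈ uIcc z.re w.re → ContinuousOn (fun y : ℝ => F (q + y * I)) (uIcc z.im w.im) := by
      intro q hq
      refine (hc.mono hzw).comp (by fun_prop) ?_
      intro y hy
      exact ⟨by simpa using hq, by simpa using hy⟩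
    have ad : ∀ q : ℝ, q ∈ uIcc z.re w.re → (∫ y : ℝ in z.im..w.im, F (q + y * I)) =
        (∫ y : ℝ in z.im..0, F (q + y * I)) + ∫ y : ℝ in (0:ℝ)..w.im, F (q + y * I) := by
      intro q hq
      rw [intervalIntegral.integral_add_adjacent_intervals]
      · exact ((hIntg q hq).mono (uIcc_subset_uIcc_left h0')).intervalIntegrable
      · exact ((hIntg q hq).mono (uIcc_subset_uIcc_right h0')).intervalIntegrable
    rw [ad _ right_mem_uIcc, ad _ left_mem_uIcc]
    simp only [ofReal_re, ofReal_im, smul_eq_mul] at k1 k2 ⊢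
    linear_combination k1 + k2
  · exact key z w hzw (fun y hy h => h0 (h ▸ hy))

/-- Reflection principle combined with the maximum principle. -/
lemma eventually_const_of_localmax {f : ℂ → ℂ} {v : ℂ → ℝ} {p r c : ℝ} (hr : 0 < r)
    (hf : DifferentiableOn ℂ f UHP)
    (hre : ∀ x : ℝ, |x - p| < r → Tendsto (fun z => (f z).re) (𝓝[UHP] (x : ℂ)) (𝓝 c))
    (hv : ∀ z ∈ UHP, v z = (f z).im)
    (hvc : ContinuousOn v (closure UHP ∩ ball (p : ℂ) r))
    (hmax : ∀ z ∈ closure UHP ∩ ball (p : ℂ) r, v z ≤ v p) :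
    ∀ᶠ z in 𝓝[UHP] (p : ℂ), v z = v p := by
  set ρ : ℂ → ℝ := fun z => if 0 < z.im then (f z).re else c with hρ
  have hρc : ContinuousOn ρ (closure UHP ∩ ball (p : ℂ) r) := by
    rintro z ⟨hz, hzb⟩
    rw [mem_cUHP] at hz
    rcases hz.lt_or_eq with h | h
    · have : ContinuousAt (fun z => (f z).re) z :=
        Complex.continuous_re.continuousAt.comp
          ((hf z h).differentiableAt (isOpen_UHP.mem_nhds h)).continuousAt
      refine (this.congr ?_).continuousWithinAt
      filter_upwards [isOpen_UHP.mem_nhds h] with w hw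
      exact (if_pos hw).symm
    · obtain ⟨x, rfl⟩ : ∃ x : ℝ, z = x := ⟨z.re, by apply Complex.ext <;> simp [← h]⟩
      have hx : |x - p| < r := by
        rw [mem_ball, Complex.dist_of_im_eq (by simp)] at hzb
        simpa [Real.dist_eq] using hzb
      have h1 := hre x hx
      have hρx : ρ x = c := by simp [hρ]
      unfold ContinuousWithinAt
      rw [hρx]
      rw [Metric.tendsto_nhds] at h1 ⊢
      intro ε hε
      have h2 := h1 ε hε
      rw [eventually_nhdsWithin_iff] at h2
      apply eventually_nhdsWithin_of_eventually_nhds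
      filter_upwards [h2] with w hw
      by_cases hw' : 0 < w.im
      · simpa [hρ, hw'] using hw hw'
      · simpa [hρ, hw'] using hε
  set G : ℂ → ℂ := fun z => Complex.exp ((v z : ℂ) - I * ((ρ z : ℂ) - c)) with hG
  have hGc : ContinuousOn G (closure UHP ∩ ball (p : ℂ) r) := by
    have a1 : ContinuousOn (fun z => (v z : ℂ)) (closure UHP ∩ ball (p : ℂ) r) :=
      Complex.continuous_ofReal.comp_continuousOn hvc
    have a2 : ContinuousOn (fun z => (ρ z : ℂ)) (closure UHP ∩ ball (p : ℂ) r) :=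
      Complex.continuous_ofReal.comp_continuousOn hρc
    exact Complex.continuous_exp.comp_continuousOn
      (a1.sub (continuousOn_const.mul (a2.sub continuousOn_const)))
  have hGn : ∀ z, ‖G z‖ = Real.exp (v z) := by
    intro z; simp [hG, Complex.norm_exp]
  have hconjball : ∀ z ∈ ball (p : ℂ) r, (starRingEnd ℂ) z ∈ ball (p : ℂ) r := by
    intro z hz
    rw [mem_ball, Complex.dist_eq] at hz ⊢
    rw [← Complex.norm_conj] at hz
    simpa using hz
  set F : ℂ → ℂ := fun z => if 0 ≤ z.im then G z else (starRingEnd ℂ) (G ((starRingEnd ℂ) z))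
    with hF
  have hFc : ContinuousOn F (ball (p : ℂ) r) := by
    apply ContinuousOn.if
    · rintro z ⟨hz, hfr⟩
      rw [Complex.frontier_setOfPred_le_im] at hfr
      have him : z.im = 0 := hfr
      have hcz : (starRingEnd ℂ) z = z := by
        apply Complex.ext <;> simp [him]
      rw [hcz]
      have : ρ z = c := by simp [hρ, him]
      simp [hG, this, ← Complex.exp_conj]
    · refine hGc.mono ?_
      rintro z ⟨hz, hz2⟩
      refine ⟨?_, hz⟩
      rw [mem_cUHP]
      have : IsClosed {a : ℂ | 0 ≤ a.im} := isClosed_le continuous_const Complex.continuous_im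
      rw [this.closure_eq] at hz2
      exact hz2
    · refine Complex.continuous_conj.comp_continuousOn
        (hGc.comp Complex.continuous_conj.continuousOn ?_)
      rintro z ⟨hz, hz2⟩
      refine ⟨?_, hconjball z hz⟩
      rw [mem_cUHP]
      have h3 : closure {a : ℂ | ¬ 0 ≤ a.im} ⊆ {a : ℂ | a.im ≤ 0} := by
        apply closure_minimal
        · intro a ha; simp at ha; exact ha.le
        · exact isClosed_le Complex.continuous_im continuous_const
      have := h3 hz2
      simpa using this
  have hGd : ∀ z, 0 < z.im → DifferentiableAt ℂ G z := by
    intro z hz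
    have : DifferentiableAt ℂ (fun z => Complex.exp (- I * (f z - c))) z := by
      have := (hf z hz).differentiableAt (isOpen_UHP.mem_nhds hz)
      fun_prop
    refine this.congr_of_eventuallyEq ?_
    filter_upwards [isOpen_UHP.mem_nhds (mem_UHP.2 hz)] with w hw
    simp only [hG]
    congr 1
    have h1 : ρ w = (f w).re := if_pos hw
    rw [h1, hv w hw]
    apply Complex.ext <;> simp
  have hFd : ∀ z ∈ ball (p : ℂ) r, z.im ≠ 0 → DifferentiableAt ℂ F z := by
    intro z hz him
    rcases lt_or_gt_of_ne him with h | h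
    · have h1 : DifferentiableAt ℂ ((starRingEnd ℂ) ∘ G ∘ (starRingEnd ℂ)) z := by
        have := (hGd ((starRingEnd ℂ) z) (by simpa using h))
        exact (differentiableAt_conj_conj_iff).2 this
      refine h1.congr_of_eventuallyEq ?_
      have : {w : ℂ | w.im < 0} ∈ 𝓝 z :=
        (isOpen_lt Complex.continuous_im continuous_const).mem_nhds h
      filter_upwards [this] with w hw
      simp only [hF, Function.comp]
      rw [if_neg (not_le.2 hw)]
    · refine (hGd z h).congr_of_eventuallyEq ?_
      filter_upwards [isOpen_UHP.mem_nhds (mem_UHP.2 h)] with w hw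
      exact if_pos (le_of_lt hw)
  have hFD := differentiableOn_of_off_real hFc hFd
  have hFp : F p = G p := by simp [hF]
  have hlm : IsLocalMax (norm ∘ F) (p : ℂ) := by
    filter_upwards [isOpen_ball.mem_nhds (mem_ball_self (x := (p : ℂ)) hr)] with z hz
    simp only [Function.comp, hFp, hGn]
    by_cases h : 0 ≤ z.im
    · simp only [hF, if_pos h, hGn]
      exact Real.exp_le_exp.2 (hmax z ⟨mem_cUHP.2 h, hz⟩)
    · simp only [hF, if_neg h, Complex.norm_conj, hGn]
      refine Real.exp_le_exp.2 (hmax _ ⟨mem_cUHP.2 ?_, hconjball z hz⟩)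
      simp at h ⊢; linarith
  have hev := Complex.eventually_eq_of_isLocalMax_norm (f := F) (c := (p : ℂ)) (by
    filter_upwards [isOpen_ball.mem_nhds (mem_ball_self (x := (p : ℂ)) hr)] with z hz
    exact (hFD z hz).differentiableAt (isOpen_ball.mem_nhds hz)) hlm
  apply eventually_nhdsWithin_of_eventually_nhds (s := UHP) at hev
  filter_upwards [hev, self_mem_nhdsWithin] with z hz hzU
  have h1 : F z = G z := if_pos (le_of_lt hzU)
  rw [h1, hFp] at hz
  have := congrArg norm hz
  rw [hGn, hGn] at this
  exact Real.exp_injective this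

/-- Interior version. -/
lemma eventually_const_of_localmax_int {f : ℂ → ℂ} {v : ℂ → ℝ} {p : ℂ} (hp : p ∈ UHP)
    (hf : DifferentiableOn ℂ f UHP)
    (hv : ∀ z ∈ UHP, v z = (f z).im)
    (hmax : ∀ᶠ z in 𝓝 p, v z ≤ v p) :
    ∀ᶠ z in 𝓝 p, v z = v p := by
  have hn : ∀ z ∈ UHP, ‖Complex.exp (-I * f z)‖ = Real.exp (v z) := by
    intro z hz; rw [hv z hz]; simp [Complex.norm_exp]
  have hU := isOpen_UHP.mem_nhds hp
  have hev := Complex.eventually_eq_of_isLocalMax_norm (f := fun z => Complex.exp (-I * f z))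
    (c := p) (by
      filter_upwards [hU] with z hz
      have := (hf z hz).differentiableAt (isOpen_UHP.mem_nhds hz)
      fun_prop) (by
      filter_upwards [hmax, hU] with z hz hzU
      simp only [Function.comp]
      rw [hn z hzU, hn p hp]
      exact Real.exp_le_exp.2 hz)
  filter_upwards [hev, hU] with z hz hzU
  have := congrArg norm hz
  rw [hn z hzU, hn p hp] at this
  exact Real.exp_injective this

/-- A branch of the logarithm, analytic on a neighbourhood of the closed upper half-plane
minus the origin. -/
def Lg (w : ℂ) : ℂ := Complex.log (-I * w) + I * (Real.pi / 2 : ℝ)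

lemma rot_mem_slitPlane {w : ℂ} (h : 0 ≤ w.im) (h0 : w ≠ 0) : -I * w ∈ slitPlane := by
  rw [mem_slitPlane_iff]
  rcases h.lt_or_eq with h | h
  · left; simpa using h
  · right
    intro h2
    apply h0
    apply Complex.ext
    · simpa using h2
    · simp [← h]

lemma Lg_hasDerivAt {w : ℂ} (h : 0 ≤ w.im) (h0 : w ≠ 0) : HasDerivAt Lg w⁻¹ w := by
  have h1 : HasDerivAt (fun w : ℂ => -I * w) (-I) w := by
    simpa using (hasDerivAt_id w).const_mul (-I)
  have h2 := (h1.clog (rot_mem_slitPlane h h0)).add_const (I * (Real.pi / 2 : ℝ))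
  have e : w⁻¹ = -I / (-I * w) := by
    rw [div_eq_mul_inv, mul_inv, ← mul_assoc, mul_inv_cancel₀ (by simp), one_mul]
  rw [e]
  exact h2

lemma Lg_sub_hasDerivAt {w : ℂ} {a : ℝ} (h : 0 ≤ w.im) (h0 : w ≠ a) :
    HasDerivAt (fun w => Lg (w - a)) (w - a)⁻¹ w := by
  have h1 : HasDerivAt Lg (w - a)⁻¹ (w - a) :=
    Lg_hasDerivAt (by simpa using h) (sub_ne_zero.2 h0)
  exact h1.comp_sub_const w (a : ℂ)

lemma Lg_re (w : ℂ) : (Lg w).re = Real.log ‖w‖ := by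
  simp [Lg, Complex.log_re]

lemma Lg_im_bound (w : ℂ) : |(Lg w).im| ≤ 2 * Real.pi := by
  have h1 := Complex.abs_arg_le_pi (-I * w)
  have h2 : (Lg w).im = Complex.arg (-I * w) + Real.pi / 2 := by
    simp only [Lg, Complex.add_im, Complex.log_im, Complex.mul_im, Complex.I_re, Complex.I_im,
      Complex.ofReal_re, Complex.ofReal_im]
    ring
  rw [h2]
  have := Real.pi_pos
  rw [abs_le] at h1 ⊢
  constructor <;> linarith

lemma Lg_im_pos {x : ℝ} (h : 0 < x) : (Lg x).im = 0 := by
  have : -I * (x : ℂ) = x * (-I) := by ring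
  simp only [Lg, this, Complex.add_im, Complex.log_im, Complex.arg_real_mul _ h, Complex.arg_neg_I,
    Complex.mul_im, Complex.I_re, Complex.I_im, Complex.ofReal_re, Complex.ofReal_im]
  ring

lemma Lg_im_neg {x : ℝ} (h : x < 0) : (Lg x).im = Real.pi := by
  have : -I * (x : ℂ) = ((-x : ℝ) : ℂ) * I := by push_cast; ring
  have hx : 0 < -x := by linarith
  simp only [Lg, this, Complex.add_im, Complex.log_im, Complex.arg_real_mul _ hx, Complex.arg_I,
    Complex.mul_im, Complex.I_re, Complex.I_im, Complex.ofReal_re, Complex.ofReal_im]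
  ring

lemma Lg_im_locconst {x p a : ℝ} (h : |x - p| < |p - a|) :
    (Lg ((x : ℂ) - a)).im = (Lg ((p : ℂ) - a)).im := by
  rw [← Complex.ofReal_sub, ← Complex.ofReal_sub]
  rcases lt_trichotomy p a with h1 | h1 | h1
  · rw [abs_of_neg (by linarith : p - a < 0)] at h
    have := (abs_lt.1 h).2
    rw [Lg_im_neg (by linarith), Lg_im_neg (by linarith)]
  · subst h1
    simp at h
    exact absurd h (not_lt.2 (abs_nonneg _))
  · rw [abs_of_pos (by linarith : 0 < p - a)] at h
    have := (abs_lt.1 h).1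
    rw [Lg_im_pos (by linarith), Lg_im_pos (by linarith)]

lemma UHP_subset_diff (t s : ℝ) : UHP ⊆ closure UHP \ {(t : ℂ), (s : ℂ)} := by
  intro z hz
  refine ⟨subset_closure hz, ?_⟩
  rintro (rfl | rfl) <;> simp [mem_UHP] at hz

lemma real_mem_diff {t s p : ℝ} (h1 : p ≠ t) (h2 : p ≠ s) :
    (p : ℂ) ∈ closure UHP \ {(t : ℂ), (s : ℂ)} := by
  refine ⟨real_mem_cUHP p, ?_⟩
  simp [h1, h2]

lemma log_aux {z : ℂ} {a t ρ : ℝ} (hρ : 0 < ρ) (hz : ρ ≤ ‖z - a‖) (hzt : z ≠ t) :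
    Real.log ‖z - t‖ ≤ Real.log (1 + |t - a| / ρ) + Real.log ‖z - a‖ := by
  have h1 : 0 < ‖z - t‖ := norm_pos_iff.2 (sub_ne_zero.2 hzt)
  have h2 : 0 < ‖z - a‖ := hρ.trans_le hz
  have h3 : 0 < 1 + |t - a| / ρ := by positivity
  rw [← Real.log_mul h3.ne' h2.ne']
  apply Real.log_le_log h1
  have h4 : ‖z - t‖ ≤ ‖z - a‖ + |t - a| := by
    have : z - t = (z - a) - ((t - a : ℝ) : ℂ) := by push_cast; ring
    rw [this]
    refine (norm_sub_le _ _).trans ?_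
    rw [Complex.norm_real, Real.norm_eq_abs]
  have h5 : |t - a| ≤ |t - a| / ρ * ‖z - a‖ := by
    rw [div_mul_eq_mul_div, le_div_iff₀ hρ]
    exact mul_le_mul_of_nonneg_left hz (abs_nonneg _)
  linarith

set_option maxHeartbeats 1000000 in
lemma max_principle {f : ℂ → ℂ} {v : ℂ → ℝ} {t s a M B : ℝ} (hat : a ≠ t) (has : a ≠ s)
    (hf : DifferentiableOn ℂ f UHP) (hv : ∀ z ∈ UHP, v z = (f z).im)
    (hvc : ContinuousOn v (closure UHP \ {(t : ℂ), (s : ℂ)}))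
    (hM0 : ∀ z ∈ UHP, v z ≤ M) (ha : v a ≤ B)
    (hbd : ∀ p : ℝ, p ≠ t → p ≠ s → v p ≤ B ∨ ∃ r > 0, ∃ c : ℝ, ∀ x : ℝ, |x - p| < r →
      Tendsto (fun z => (f z).re) (𝓝[UHP] (x : ℂ)) (𝓝 c)) :
    ∀ z ∈ UHP, v z ≤ B := by
  intro z0 hz0
  by_contra! hlt
  have hM : ∀ z ∈ closure UHP \ {(t : ℂ), (s : ℂ)}, v z ≤ M := by
    intro z hz
    have h1 : Tendsto v (𝓝[UHP] z) (𝓝 (v z)) := (hvc z hz).mono (UHP_subset_diff t s)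
    have := mem_closure_iff_nhdsWithin_neBot.1 hz.1
    exact le_of_tendsto h1 (by filter_upwards [self_mem_nhdsWithin] with w hw using hM0 w hw)
  obtain ⟨η, hη, hη2⟩ : ∃ η > 0, v z0 = B + 2 * η := ⟨(v z0 - B) / 2, by linarith, by ring⟩
  -- radius around a
  obtain ⟨ρ, hρ, hρB⟩ : ∃ ρ > 0, ∀ z ∈ closure UHP, z ≠ t → z ≠ s → ‖z - a‖ ≤ ρ →
      v z < B + η := by
    have h1 := hvc a (real_mem_diff hat has)
    have h2 : ∀ᶠ z in 𝓝[closure UHP \ {(t : ℂ), (s : ℂ)}] (a : ℂ), v z < B + η :=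
      h1.eventually (gt_mem_nhds (by linarith))
    rw [eventually_nhdsWithin_iff, Metric.eventually_nhds_iff] at h2
    obtain ⟨ε, hε, h3⟩ := h2
    refine ⟨ε / 2, by positivity, fun z hz hzt hzs hza => h3 ?_ ⟨hz, by simp [hzt, hzs]⟩⟩
    rw [Complex.dist_eq]; linarith
  set ell : ℂ → ℝ := fun z => Real.log ‖z - t‖ + Real.log ‖z - s‖ - 3 * Real.log ‖z - a‖ with hell
  set κt := Real.log (1 + |t - a| / ρ) with hκt
  set κs := Real.log (1 + |s - a| / ρ) with hκs
  set C0 := κt + κs - Real.log ρ with hC0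
  have hz0t : z0 ≠ t := fun h => by simp [h, mem_UHP] at hz0
  have hz0s : z0 ≠ s := fun h => by simp [h, mem_UHP] at hz0
  obtain ⟨ε, hε, hε2⟩ : ∃ ε > 0, B + η + ε * C0 < v z0 + ε * ell z0 := by
    refine ⟨η / (|C0 - ell z0| + 1), by positivity, ?_⟩
    have h1 : η / (|C0 - ell z0| + 1) * (C0 - ell z0) < η := by
      rw [div_mul_eq_mul_div, div_lt_iff₀ (by positivity)]
      have := le_abs_self (C0 - ell z0)
      nlinarith
    rw [hη2]; linarith
  set vε : ℂ → ℝ := fun z => v z + ε * ell z with hvε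
  set m := vε z0 with hm
  have hb1 : ∀ z : ℂ, ρ ≤ ‖z - a‖ → z ≠ t → z ≠ s → ell z ≤ κt + κs - Real.log ‖z - a‖ := by
    intro z h1 h2 h3
    have := log_aux hρ h1 h2
    have := log_aux hρ h1 h3
    simp only [hell]; linarith
  have hb0 : ∀ z : ℂ, ρ ≤ ‖z - a‖ → z ≠ t → z ≠ s → ell z ≤ C0 := by
    intro z h1 h2 h3
    have := hb1 z h1 h2 h3
    have := Real.log_le_log hρ h1
    linarith
  have hbt : ∀ z : ℂ, ρ ≤ ‖z - a‖ → z ≠ t → z ≠ s →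
      ell z ≤ Real.log ‖z - t‖ + (κs - 2 * Real.log ρ) := by
    intro z h1 h2 h3
    have := log_aux hρ h1 h3
    have := Real.log_le_log hρ h1
    simp only [hell]; linarith
  have hbs : ∀ z : ℂ, ρ ≤ ‖z - a‖ → z ≠ t → z ≠ s →
      ell z ≤ Real.log ‖z - s‖ + (κt - 2 * Real.log ρ) := by
    intro z h1 h2 h3
    have := log_aux hρ h1 h2
    have := Real.log_le_log hρ h1
    simp only [hell]; linarith
  set Rb := Real.exp (κt + κs + (M - m) / ε) with hRb
  set δt := Real.exp ((m - M) / ε - (κs - 2 * Real.log ρ)) with hδt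
  set δs := Real.exp ((m - M) / ε - (κt - 2 * Real.log ρ)) with hδs
  set K : Set ℂ := {z | 0 ≤ z.im ∧ ρ ≤ ‖z - a‖ ∧ ‖z - a‖ ≤ Rb ∧ δt ≤ ‖z - t‖ ∧ δs ≤ ‖z - s‖}
    with hK
  have hKc : IsCompact K := by
    apply (isCompact_closedBall (a : ℂ) Rb).of_isClosed_subset
    · have cn : ∀ x : ℝ, Continuous (fun z : ℂ => ‖z - x‖) := fun x => by fun_prop
      exact (isClosed_le continuous_const Complex.continuous_im).inter
        ((isClosed_le continuous_const (cn a)).inter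
        ((isClosed_le (cn a) continuous_const).inter
        ((isClosed_le continuous_const (cn t)).inter (isClosed_le continuous_const (cn s)))))
    · intro z hz
      rw [mem_closedBall, Complex.dist_eq]
      exact hz.2.2.1
  have hne_t : ∀ z ∈ K, z ≠ t := by
    intro z hz h
    have := hz.2.2.2.1
    rw [h, sub_self, norm_zero] at this
    exact absurd (Real.exp_pos _) (not_lt.2 this)
  have hne_s : ∀ z ∈ K, z ≠ s := by
    intro z hz h
    have := hz.2.2.2.2
    rw [h, sub_self, norm_zero] at this
    exact absurd (Real.exp_pos _) (not_lt.2 this)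
  have hne_a : ∀ z : ℂ, ρ ≤ ‖z - a‖ → z ≠ a := by
    intro z hz h
    rw [h, sub_self, norm_zero] at hz
    linarith
  have hmem : ∀ z : ℂ, 0 ≤ z.im → ρ ≤ ‖z - a‖ → z ≠ t → z ≠ s → m ≤ vε z → z ∈ K := by
    intro z h1 h2 h3 h4 h5
    have hMz : v z ≤ M := hM z ⟨mem_cUHP.2 h1, by simp [h3, h4]⟩
    have key : (m - M) / ε ≤ ell z := by
      rw [div_le_iff₀ hε]
      simp only [hvε] at h5
      linarith
    have key2 : (M - m) / ε = - ((m - M) / ε) := by ring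
    refine ⟨h1, h2, ?_, ?_, ?_⟩
    · have := hb1 z h2 h3 h4
      rw [hRb, ← Real.log_le_iff_le_exp (hρ.trans_le h2)]
      linarith
    · have := hbt z h2 h3 h4
      rw [hδt, ← Real.le_log_iff_exp_le (norm_pos_iff.2 (sub_ne_zero.2 h3))]
      linarith
    · have := hbs z h2 h3 h4
      rw [hδs, ← Real.le_log_iff_exp_le (norm_pos_iff.2 (sub_ne_zero.2 h4))]
      linarith
  have hz0K : z0 ∈ K := by
    refine hmem z0 (le_of_lt hz0) ?_ hz0t hz0s le_rfl
    by_contra! h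
    have := hρB z0 (subset_closure hz0) hz0t hz0s h.le
    linarith
  have hellc : ∀ z : ℂ, z ≠ t → z ≠ s → z ≠ a → ContinuousAt ell z := by
    intro z h1 h2 h3
    have e1 : ‖z - t‖ ≠ 0 := norm_ne_zero_iff.2 (sub_ne_zero.2 h1)
    have e2 : ‖z - s‖ ≠ 0 := norm_ne_zero_iff.2 (sub_ne_zero.2 h2)
    have e3 : ‖z - a‖ ≠ 0 := norm_ne_zero_iff.2 (sub_ne_zero.2 h3)
    have c1 : ContinuousAt (fun z : ℂ => Real.log ‖z - t‖) z :=
      ContinuousAt.log (by fun_prop) e1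
    have c2 : ContinuousAt (fun z : ℂ => Real.log ‖z - s‖) z :=
      ContinuousAt.log (by fun_prop) e2
    have c3 : ContinuousAt (fun z : ℂ => Real.log ‖z - a‖) z :=
      ContinuousAt.log (by fun_prop) e3
    exact (c1.add c2).sub (continuousAt_const.mul c3)
  have hvεc : ∀ S : Set ℂ, S ⊆ closure UHP \ {(t : ℂ), (s : ℂ)} → (a : ℂ) ∉ S →
      ContinuousOn vε S := by
    intro S hS haS
    refine (hvc.mono hS).add (continuousOn_const.mul ?_)
    intro z hz
    have := (hS hz).2
    simp at this
    exact (hellc z this.1 this.2 (fun h => haS (h ▸ hz))).continuousWithinAt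
  have hKsub : K ⊆ closure UHP \ {(t : ℂ), (s : ℂ)} := by
    intro z hz
    exact ⟨mem_cUHP.2 hz.1, by simp [hne_t z hz, hne_s z hz]⟩
  have haK : (a : ℂ) ∉ K := fun h => hne_a _ h.2.1 rfl
  have hcK := hvεc K hKsub haK
  obtain ⟨p0, hp0K, hp0⟩ := hKc.exists_isMaxOn ⟨z0, hz0K⟩ hcK
  set A : Set ℂ := K ∩ vε ⁻¹' {vε p0} with hA
  have hAc : IsCompact A :=
    hKc.of_isClosed_subset (hcK.preimage_isClosed_of_isClosed hKc.isClosed isClosed_singleton)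
      inter_subset_left
  obtain ⟨p, hpA, hpmax⟩ := hAc.exists_isMaxOn (f := fun z => ‖z - a‖) ⟨p0, hp0K, rfl⟩
    (by fun_prop)
  have hpK := hpA.1
  have hpv : vε p = vε p0 := hpA.2
  have hmle : m ≤ vε p := by rw [hpv]; exact hp0 hz0K
  have hglob : ∀ z : ℂ, 0 ≤ z.im → ρ ≤ ‖z - a‖ → z ≠ t → z ≠ s → vε z ≤ vε p := by
    intro z h1 h2 h3 h4
    by_cases h5 : m ≤ vε z
    · rw [hpv]; exact hp0 (hmem z h1 h2 h3 h4 h5)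
    · push Not at h5; linarith
  have hpt := hne_t p hpK
  have hps := hne_s p hpK
  have hpa := hne_a p hpK.2.1
  have hpell := hb0 p hpK.2.1 hpt hps
  have hpv2 : B + η < v p := by
    have : vε p = v p + ε * ell p := rfl
    have h2 : m = v z0 + ε * ell z0 := rfl
    nlinarith
  have hpρ : ρ < ‖p - a‖ := by
    rcases hpK.2.1.lt_or_eq with h | h
    · exact h
    · exfalso
      have := hρB p (mem_cUHP.2 hpK.1) hpt hps h.ge
      linarith
  -- perturbed holomorphic function
  set Lam : ℂ → ℂ := fun z => Lg (z - t) + Lg (z - s) - 3 * Lg (z - a) with hLam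
  set fε : ℂ → ℂ := fun z => f z + I * ε * Lam z with hfε
  have hLamd : ∀ z : ℂ, 0 ≤ z.im → z ≠ t → z ≠ s → z ≠ a → DifferentiableAt ℂ Lam z := by
    intro z h0 h1 h2 h3
    exact ((Lg_sub_hasDerivAt h0 h1).differentiableAt.add
      (Lg_sub_hasDerivAt h0 h2).differentiableAt).sub
      ((Lg_sub_hasDerivAt h0 h3).differentiableAt.const_mul 3)
  have hneU : ∀ z ∈ UHP, ∀ x : ℝ, z ≠ x := by
    intro z hz x h
    simp [h, mem_UHP] at hz
  have hfεd : DifferentiableOn ℂ fε UHP := by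
    intro z hz
    have h1 := (hLamd z (le_of_lt hz) (hneU z hz t) (hneU z hz s)
      (hneU z hz a)).differentiableWithinAt (s := UHP)
    exact (hf z hz).add (h1.const_mul (I * ε))
  have hvfε : ∀ z ∈ UHP, vε z = (fε z).im := by
    intro z hz
    have : (Lam z).re = ell z := by
      simp [hLam, hell, Lg_re]
    simp only [hvε, hfε, Complex.add_im, hv z hz, mul_assoc]
    rw [Complex.I_mul_im, Complex.re_ofReal_mul, this]
  have hKev : ∀ᶠ z : ℂ in 𝓝 p, ρ < ‖z - a‖ ∧ z ≠ t ∧ z ≠ s := by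
    have c1 : ∀ᶠ z : ℂ in 𝓝 p, ρ < ‖z - a‖ := by
      have : ContinuousAt (fun z : ℂ => ‖z - a‖) p := by fun_prop
      exact this.eventually (lt_mem_nhds hpρ)
    filter_upwards [c1, isOpen_ne.mem_nhds hpt, isOpen_ne.mem_nhds hps] with z h1 h2 h3
    exact ⟨h1, h2, h3⟩
  have hconst : ∀ᶠ z in 𝓝[UHP] p, vε z = vε p := by
    rcases hpK.1.lt_or_eq with him | him
    · apply eventually_nhdsWithin_of_eventually_nhds
      apply eventually_const_of_localmax_int (f := fε) him hfεd hvfε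
      filter_upwards [hKev, isOpen_UHP.mem_nhds (mem_UHP.2 him)] with z hz hzU
      exact hglob z (le_of_lt hzU) hz.1.le hz.2.1 hz.2.2
    · obtain ⟨q, rfl⟩ : ∃ q : ℝ, p = q := ⟨p.re, by apply Complex.ext <;> simp [← him]⟩
      have hqt : q ≠ t := fun h => hpt (by rw [h])
      have hqs : q ≠ s := fun h => hps (by rw [h])
      have hqa : q ≠ a := fun h => hpa (by rw [h])
      rcases hbd q hqt hqs with h | ⟨r, hr, c, hrc⟩
      · linarith
      · rw [Metric.eventually_nhds_iff] at hKev
        obtain ⟨r1, hr1, hKev⟩ := hKev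
        have a1 : 0 < |q - t| := abs_pos.2 (sub_ne_zero.2 hqt)
        have a2 : 0 < |q - s| := abs_pos.2 (sub_ne_zero.2 hqs)
        have a3 : 0 < |q - a| := abs_pos.2 (sub_ne_zero.2 hqa)
        have hr' : 0 < min (min r r1) (min |q - t| (min |q - s| |q - a|)) := by positivity
        apply eventually_const_of_localmax (f := fε) (c := c - ε * (Lam q).im) hr' hfεd ?_ hvfε ?_ ?_
        · intro x hx
          simp only [lt_min_iff] at hx
          obtain ⟨⟨hx1, hx2⟩, hx3, hx4, hx5⟩ := hx
          have hxt : x ≠ t := by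
            rintro rfl; rw [abs_sub_comm] at hx3; exact lt_irrefl _ hx3
          have hxs : x ≠ s := by
            rintro rfl; rw [abs_sub_comm] at hx4; exact lt_irrefl _ hx4
          have hxa : x ≠ a := by
            rintro rfl; rw [abs_sub_comm] at hx5; exact lt_irrefl _ hx5
          have hLx : (Lam x).im = (Lam q).im := by
            simp only [hLam, Complex.sub_im, Complex.add_im, Complex.mul_im]
            rw [Lg_im_locconst hx3, Lg_im_locconst hx4, Lg_im_locconst hx5]
            simp
          have c1 : ContinuousAt Lam x := (hLamd x (by simp) (by exact_mod_cast hxt)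
            (by exact_mod_cast hxs) (by exact_mod_cast hxa)).continuousAt
          have c2 : Tendsto (fun z => (Lam z).im) (𝓝[UHP] (x : ℂ)) (𝓝 (Lam x).im) :=
            ((Complex.continuous_im.continuousAt.comp c1).tendsto).mono_left nhdsWithin_le_nhds
          rw [hLx] at c2
          have c3 := (hrc x hx1).sub (c2.const_mul ε)
          refine c3.congr (fun z => ?_)
          simp only [hfε, Complex.add_re, mul_assoc]
          rw [Complex.I_mul_re, Complex.im_ofReal_mul]
          ring
        · apply hvεc
          · rintro z ⟨hz1, hz2⟩
            have := hKev (lt_of_lt_of_le (mem_ball.1 hz2) ((min_le_left _ _).trans (min_le_right _ _)))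
            exact ⟨hz1, by simp [this.2.1, this.2.2]⟩
          · rintro ⟨hz1, hz2⟩
            have := hKev (lt_of_lt_of_le (mem_ball.1 hz2) ((min_le_left _ _).trans (min_le_right _ _)))
            exact hne_a _ this.1.le rfl
        · rintro z ⟨hz1, hz2⟩
          have := hKev (lt_of_lt_of_le (mem_ball.1 hz2) ((min_le_left _ _).trans (min_le_right _ _)))
          exact hglob z (mem_cUHP.1 hz1) this.1.le this.2.1 this.2.2
  -- move outwards
  have htend : Tendsto (fun δ : ℝ => p + δ * (p - a) + δ * I) (𝓝[>] 0) (𝓝[UHP] p) := by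
    rw [tendsto_nhdsWithin_iff]
    constructor
    · have : Continuous (fun δ : ℝ => p + δ * (p - a) + δ * I) := by fun_prop
      have h := this.tendsto 0
      simp only [Complex.ofReal_zero, zero_mul, add_zero] at h
      exact h.mono_left nhdsWithin_le_nhds
    · filter_upwards [self_mem_nhdsWithin] with δ hδ
      have hδ' : 0 < δ := hδ
      have := hpK.1
      have : 0 ≤ δ * p.im := by positivity
      simp [mem_UHP]
      linarith [hpK.1]
  obtain ⟨δ, ⟨hδ1, hδ2⟩, hδ3⟩ := (((htend.eventually hconst).and
    (htend.eventually (eventually_nhdsWithin_of_eventually_nhds hKev))).and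
    (self_mem_nhdsWithin : Ioi (0:ℝ) ∈ 𝓝[>] 0)).exists
  have hδ : 0 < δ := hδ3
  set w := p + δ * (p - a) + δ * I with hw
  have hwim : 0 ≤ w.im := by
    have := hpK.1
    simp [hw]; positivity
  have hwK : w ∈ K := hmem w hwim hδ2.1.le hδ2.2.1 hδ2.2.2 (by rw [hδ1]; exact hmle)
  have hwA : w ∈ A := ⟨hwK, by simp only [mem_preimage, mem_singleton_iff]; rw [hδ1, hpv]⟩
  have h1 : ‖w - a‖ ≤ ‖p - a‖ := hpmax hwA
  have h2 : ‖w - a‖ ^ 2 ≤ ‖p - a‖ ^ 2 := by gcongr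
  rw [← Complex.normSq_eq_norm_sq, ← Complex.normSq_eq_norm_sq, Complex.normSq_apply,
    Complex.normSq_apply] at h2
  simp [hw] at h2
  have h3 := hpK.1
  have h4 : 0 ≤ δ * p.im * δ := by positivity
  have h5 : 0 ≤ δ * p.im * p.im := by positivity
  have h6 : 0 ≤ δ * (p.re - a) * (p.re - a) := by
    have := mul_self_nonneg (p.re - a); nlinarith
  nlinarith [mul_pos hδ hδ, mul_nonneg h3 hδ.le, mul_self_nonneg (δ * (p.re - a)), mul_self_nonneg (δ * p.im)]

lemma integrable_bd : MeasureTheory.IntegrableOn (fun τ : ℝ => 1 / (√τ * (1 + τ))) (Ioi 0) := by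
  have hmeas : Measurable (fun τ : ℝ => 1 / (√τ * (1 + τ))) := by fun_prop
  rw [← Ioc_union_Ioi_eq_Ioi zero_le_one]
  apply MeasureTheory.IntegrableOn.union
  · have h : MeasureTheory.IntegrableOn (fun τ : ℝ => τ ^ (-(1/2) : ℝ)) (Ioc 0 1) := by
      rw [← intervalIntegrable_iff_integrableOn_Ioc_of_le zero_le_one]
      exact intervalIntegral.intervalIntegrable_rpow' (by norm_num)
    refine MeasureTheory.Integrable.mono' h hmeas.aestronglyMeasurable ?_
    refine (MeasureTheory.ae_restrict_iff' measurableSet_Ioc).2 (Eventually.of_forall ?_)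
    intro τ hτ
    have h0 : 0 < τ := hτ.1
    have h1 : 0 < √τ := Real.sqrt_pos.2 h0
    rw [Real.norm_of_nonneg (by positivity), Real.rpow_neg h0.le, ← Real.sqrt_eq_rpow, ← one_div]
    apply one_div_le_one_div_of_le h1
    nlinarith
  · have h : MeasureTheory.IntegrableOn (fun τ : ℝ => τ ^ (-(3/2) : ℝ)) (Ioi 1) :=
      integrableOn_Ioi_rpow_of_lt (by norm_num) one_pos
    refine MeasureTheory.Integrable.mono' h hmeas.aestronglyMeasurable ?_
    refine (MeasureTheory.ae_restrict_iff' measurableSet_Ioi).2 (Eventually.of_forall ?_)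
    intro τ hτ
    have h0 : 0 < τ := lt_trans one_pos hτ
    have h1 : 0 < √τ := Real.sqrt_pos.2 h0
    have e : (3/2 : ℝ) = 1/2 + 1 := by norm_num
    rw [Real.norm_of_nonneg (by positivity), Real.rpow_neg h0.le, e, Real.rpow_add h0,
      ← Real.sqrt_eq_rpow, ← one_div, Real.rpow_one]
    apply one_div_le_one_div_of_le (by positivity)
    nlinarith

section prim
variable {φ : ℂ → ℂ} {C : ℝ}

lemma prim_bd (hC : 0 ≤ C) (hb : ∀ w ∈ UHP, ‖φ w‖ ≤ C * (1 / (√w.im * (1 + ‖w‖))))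
    {z : ℂ} {τ : ℝ} (hz : 0 ≤ z.im) (hτ : 0 < τ) :
    ‖φ (z + τ * I)‖ ≤ C * (1 / (√τ * (1 + τ))) := by
  have him : (z + τ * I).im = z.im + τ := by simp
  have hm : z + τ * I ∈ UHP := by rw [mem_UHP, him]; linarith
  refine (hb _ hm).trans ?_
  apply mul_le_mul_of_nonneg_left _ hC
  have h1 : 0 < √τ := Real.sqrt_pos.2 hτ
  apply one_div_le_one_div_of_le (by positivity)
  have h2 : √τ ≤ √(z + τ * I).im := Real.sqrt_le_sqrt (by rw [him]; linarith)
  have h3 : τ ≤ ‖z + τ * I‖ := by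
    have := Complex.abs_im_le_norm (z + τ * I)
    have := le_abs_self (z + τ * I).im
    rw [him] at *
    linarith
  gcongr

lemma prim_meas (hφ : DifferentiableOn ℂ φ UHP) {z : ℂ} (hz : 0 ≤ z.im) :
    MeasureTheory.AEStronglyMeasurable (fun τ : ℝ => φ (z + τ * I))
      (MeasureTheory.volume.restrict (Ioi 0)) := by
  apply ContinuousOn.aestronglyMeasurable _ measurableSet_Ioi
  apply hφ.continuousOn.comp (by fun_prop)
  intro τ hτ
  rw [mem_UHP]
  have : 0 < τ := hτ
  simp
  linarith

lemma prim_deriv (hC : 0 ≤ C) (hφ : DifferentiableOn ℂ φ UHP)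
    (hb : ∀ w ∈ UHP, ‖φ w‖ ≤ C * (1 / (√w.im * (1 + ‖w‖))))
    {z : ℂ} {τ η : ℝ} (hη : 0 < η) (hz : η ≤ z.im) (hτ : 0 < τ) :
    ‖deriv φ (z + τ * I)‖ ≤ (8 * C / η) * (1 / (√τ * (1 + τ))) := by
  have him : (z + τ * I).im = z.im + τ := by simp
  set w := z + τ * I with hw
  have hR : 0 < w.im / 2 := by rw [him]; linarith
  have h1 : 0 < √τ := Real.sqrt_pos.2 hτ
  have hsub : closedBall w (w.im / 2) ⊆ UHP := by
    intro u hu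
    rw [mem_closedBall, dist_eq_norm] at hu
    have h2 := (abs_le.1 (Complex.abs_im_le_norm (u - w))).1
    rw [mem_UHP]
    simp only [Complex.sub_im] at h2
    linarith
  have hd : DiffContOnCl ℂ φ (ball w (w.im / 2)) := by
    apply DifferentiableOn.diffContOnCl
    rw [closure_ball _ hR.ne']
    exact hφ.mono hsub
  have hs : ∀ u ∈ sphere w (w.im / 2), ‖φ u‖ ≤ 4 * C * (1 / (√τ * (1 + τ))) := by
    intro u hu
    have hu' := hsub (sphere_subset_closedBall hu)
    rw [mem_sphere, dist_eq_norm] at hu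
    have h2 := (abs_le.1 (Complex.abs_im_le_norm (u - w))).1
    simp only [Complex.sub_im] at h2
    have h3 : τ / 2 ≤ u.im := by linarith
    have h4 : τ / 2 ≤ ‖u‖ := h3.trans ((le_abs_self _).trans (Complex.abs_im_le_norm u))
    refine (hb u hu').trans ?_
    have h5 : √τ / 2 ≤ √u.im := by
      apply Real.le_sqrt_of_sq_le
      rw [div_pow, Real.sq_sqrt hτ.le]
      linarith
    have h6 : √τ * (1 + τ) / 4 ≤ √u.im * (1 + ‖u‖) := by
      have : √τ / 2 * ((1 + τ) / 2) ≤ √u.im * (1 + ‖u‖) := by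
        apply mul_le_mul h5 (by linarith) (by linarith) (Real.sqrt_nonneg _)
      linarith
    have h7 : 1 / (√u.im * (1 + ‖u‖)) ≤ 1 / (√τ * (1 + τ) / 4) :=
      one_div_le_one_div_of_le (by positivity) h6
    calc C * (1 / (√u.im * (1 + ‖u‖))) ≤ C * (1 / (√τ * (1 + τ) / 4)) :=
          mul_le_mul_of_nonneg_left h7 hC
      _ = _ := by rw [one_div_div]; ring
  refine (Complex.norm_deriv_le_of_forall_mem_sphere_norm_le hR hd hs).trans ?_
  have h8 : η / 2 ≤ w.im / 2 := by linarith
  calc 4 * C * (1 / (√τ * (1 + τ))) / (w.im / 2) ≤ 4 * C * (1 / (√τ * (1 + τ))) / (η / 2) := by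
        gcongr
    _ = _ := by field_simp; ring

lemma primitive_exists (hC : 0 ≤ C) (hφ : DifferentiableOn ℂ φ UHP)
    (hb : ∀ w ∈ UHP, ‖φ w‖ ≤ C * (1 / (√w.im * (1 + ‖w‖)))) :
    ∃ H : ℂ → ℂ, ContinuousOn H (closure UHP) ∧ (∃ M : ℝ, ∀ z ∈ closure UHP, ‖H z‖ ≤ M) ∧
      (∀ z ∈ UHP, HasDerivAt H (φ z) z) ∧
      (∀ x : ℝ, ContinuousWithinAt φ (closure UHP) x →
        HasDerivWithinAt H (φ x) (closure UHP) x) ∧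
      Tendsto (fun x : ℝ => H x) atTop (𝓝 0) ∧ Tendsto (fun x : ℝ => H x) atBot (𝓝 0) := by
  have hIntg := integrable_bd.const_mul C
  set H : ℂ → ℂ := fun z => -I * ∫ τ : ℝ in Ioi 0, φ (z + τ * I) with hH
  have hcont : ContinuousOn H (closure UHP) := by
    apply ContinuousOn.const_mul
    refine MeasureTheory.continuousOn_of_dominated (fun z hz => prim_meas hφ (mem_cUHP.1 hz))
      (fun z hz => ?_) hIntg ?_
    · refine (MeasureTheory.ae_restrict_iff' measurableSet_Ioi).2 (Eventually.of_forall ?_)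
      intro τ hτ
      exact prim_bd hC hb (mem_cUHP.1 hz) hτ
    · refine (MeasureTheory.ae_restrict_iff' measurableSet_Ioi).2 (Eventually.of_forall ?_)
      intro τ hτ
      apply hφ.continuousOn.comp (by fun_prop)
      intro z hz
      have h1 := mem_cUHP.1 hz
      have : 0 < τ := hτ
      rw [mem_UHP]
      simp
      linarith
  have hbound : ∀ z ∈ closure UHP, ‖H z‖ ≤ ∫ τ : ℝ in Ioi 0, C * (1 / (√τ * (1 + τ))) := by
    intro z hz
    rw [hH]
    simp only [norm_mul, norm_neg, Complex.norm_I, one_mul]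
    apply MeasureTheory.norm_integral_le_of_norm_le hIntg
    refine (MeasureTheory.ae_restrict_iff' measurableSet_Ioi).2 (Eventually.of_forall ?_)
    intro τ hτ
    exact prim_bd hC hb (mem_cUHP.1 hz) hτ
  have hder : ∀ z ∈ UHP, HasDerivAt H (φ z) z := by
    intro z hz
    have hz0 : 0 < z.im := hz
    have hdφ : ∀ w : ℂ, ∀ τ : ℝ, 0 ≤ τ → 0 < w.im → HasDerivAt φ (deriv φ (w + τ * I)) (w + τ * I) := by
      intro w τ hτ hw
      apply DifferentiableAt.hasDerivAt
      apply hφ.differentiableAt (isOpen_UHP.mem_nhds _)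
      rw [mem_UHP]; simp; linarith
    have key := hasDerivAt_integral_of_dominated_loc_of_deriv_le
      (μ := MeasureTheory.volume.restrict (Ioi (0 : ℝ)))
      (F := fun w (τ : ℝ) => φ (w + τ * I)) (F' := fun w (τ : ℝ) => deriv φ (w + τ * I))
      (x₀ := z) (s := ball z (z.im / 2))
      (bound := fun τ => (8 * C / (z.im / 2)) * (1 / (√τ * (1 + τ))))
      (ball_mem_nhds z (by linarith)) ?_ ?_ ?_ ?_ (integrable_bd.const_mul _) ?_
    · have h2 : ∫ τ : ℝ in Ioi 0, deriv φ (z + τ * I) * I = 0 - φ (z + (0 : ℝ) * I) := by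
        apply MeasureTheory.integral_Ioi_of_hasDerivAt_of_tendsto'
          (f := fun τ : ℝ => φ (z + τ * I))
        · intro τ hτ
          have h3 : HasDerivAt (fun τ : ℝ => z + τ * I) I τ := by
            simpa using ((Complex.ofRealCLM.hasDerivAt (x := τ)).mul_const I).const_add z
          have := (hdφ z τ hτ hz0).comp τ h3
          exact this
        · exact key.1.mul_const I
        · apply squeeze_zero_norm' (a := fun τ : ℝ => C * (1 / (√τ * (1 + τ))))
          · filter_upwards [eventually_gt_atTop 0] with τ hτ
            exact prim_bd hC hb hz0.le hτ
          · have : Tendsto (fun τ : ℝ => √τ * (1 + τ)) atTop atTop :=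
              (Real.tendsto_sqrt_atTop).atTop_mul_atTop₀
                (tendsto_atTop_add_const_left _ _ tendsto_id)
            simpa using (tendsto_inv_atTop_zero.comp this).const_mul C
      have h3 := key.2.const_mul (-I)
      have h4 : -I * ∫ τ : ℝ in Ioi 0, deriv φ (z + τ * I) = φ z := by
        have e1 : ∫ τ : ℝ in Ioi 0, deriv φ (z + τ * I) * I
            = (∫ τ : ℝ in Ioi 0, deriv φ (z + τ * I)) * I :=
          MeasureTheory.integral_mul_const _ _
        rw [e1] at h2
        simp at h2
        rw [neg_mul, mul_comm, h2, neg_neg]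
      rw [h4] at h3
      exact h3
    · filter_upwards [isOpen_UHP.mem_nhds hz] with w hw
      exact prim_meas hφ (le_of_lt hw)
    · refine MeasureTheory.Integrable.mono' hIntg (prim_meas hφ hz0.le) ?_
      refine (MeasureTheory.ae_restrict_iff' measurableSet_Ioi).2 (Eventually.of_forall ?_)
      intro τ hτ
      exact prim_bd hC hb hz0.le hτ
    · exact prim_meas (hφ.deriv isOpen_UHP) hz0.le
    · refine (MeasureTheory.ae_restrict_iff' measurableSet_Ioi).2 (Eventually.of_forall ?_)
      intro τ hτ w hw
      rw [mem_ball, dist_eq_norm] at hw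
      have h2 := (abs_le.1 (Complex.abs_im_le_norm (w - z))).1
      simp only [Complex.sub_im] at h2
      exact prim_deriv hC hφ hb (by linarith) (by linarith) hτ
    · refine (MeasureTheory.ae_restrict_iff' measurableSet_Ioi).2 (Eventually.of_forall ?_)
      intro τ hτ w hw
      rw [mem_ball, dist_eq_norm] at hw
      have h2 := (abs_le.1 (Complex.abs_im_le_norm (w - z))).1
      simp only [Complex.sub_im] at h2
      exact (hdφ w τ (le_of_lt hτ) (by linarith)).comp_add_const w _
  have hlim : ∀ l : Filter ℝ, l.IsCountablyGenerated → Tendsto (fun x : ℝ => |x|) l atTop →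
      Tendsto (fun x : ℝ => H x) l (𝓝 0) := by
    intro l hl hl2
    have h0 : (0 : ℂ) = -I * ∫ τ : ℝ in Ioi 0, (0 : ℂ) := by simp
    rw [h0]
    apply Tendsto.const_mul
    refine MeasureTheory.tendsto_integral_filter_of_dominated_convergence _
      (Eventually.of_forall fun x => prim_meas hφ (by simp))
      (Eventually.of_forall fun x => ?_) hIntg ?_
    · refine (MeasureTheory.ae_restrict_iff' measurableSet_Ioi).2 (Eventually.of_forall ?_)
      intro τ hτ
      exact prim_bd hC hb (by simp) hτ
    · refine (MeasureTheory.ae_restrict_iff' measurableSet_Ioi).2 (Eventually.of_forall ?_)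
      intro τ hτ
      have hτ0 : 0 < τ := hτ
      have h1 : 0 < √τ := Real.sqrt_pos.2 hτ0
      apply squeeze_zero_norm (a := fun x : ℝ => C * (1 / (√τ * (1 + |x|))))
      · intro x
        have him : ((x : ℂ) + τ * I).im = τ := by simp
        have hre : ((x : ℂ) + τ * I).re = x := by simp
        refine (hb _ (by rw [mem_UHP, him]; exact hτ)).trans ?_
        rw [him]
        have := Complex.abs_re_le_norm ((x : ℂ) + τ * I)
        rw [hre] at this
        gcongr
      · have : Tendsto (fun x : ℝ => √τ * (1 + |x|)) l atTop :=
          (tendsto_atTop_add_const_left _ _ hl2).const_mul_atTop h1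
        simpa using (tendsto_inv_atTop_zero.comp this).const_mul C
  refine ⟨H, hcont, ⟨_, hbound⟩, hder, ?_, hlim _ inferInstance tendsto_abs_atTop_atTop,
    hlim _ inferInstance tendsto_abs_atBot_atTop⟩
  intro x hx
  have h1 : HasFDerivWithinAt H ((ContinuousLinearMap.toSpanSingleton ℂ (φ x)).restrictScalars ℝ)
      (closure UHP) (x : ℂ) := by
    apply hasFDerivWithinAt_closure_of_tendsto_fderiv (s := UHP)
    · intro z hz
      exact ((hder z hz).differentiableAt.restrictScalars ℝ).differentiableWithinAt
    · exact convex_UHP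
    · exact isOpen_UHP
    · intro z hz
      exact (hcont z hz).mono subset_closure
    · have h2 : Tendsto (fun z => (ContinuousLinearMap.toSpanSingleton ℂ (φ z)).restrictScalars ℝ)
          (𝓝[UHP] (x : ℂ)) (𝓝 ((ContinuousLinearMap.toSpanSingleton ℂ (φ x)).restrictScalars ℝ)) := by
        have h3 : Continuous fun c : ℂ => (ContinuousLinearMap.toSpanSingleton ℂ c).restrictScalars ℝ := by
          have e : (fun c : ℂ => (ContinuousLinearMap.toSpanSingleton ℂ c).restrictScalars ℝ) =
              fun c : ℂ => c • (ContinuousLinearMap.id ℝ ℂ) := by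
            ext c x; simp [mul_comm]
          rw [e]
          fun_prop
        exact (h3.tendsto _).comp (hx.mono subset_closure)
      refine h2.congr' ?_
      filter_upwards [self_mem_nhdsWithin] with z hz
      exact ((hder z hz).hasFDerivAt.restrictScalars ℝ).fderiv.symm
  have h5 : HasFDerivWithinAt H (ContinuousLinearMap.toSpanSingleton ℂ (φ x))
      (closure UHP) (x : ℂ) := h1.of_restrictScalars ℝ rfl
  exact h5

end prim

lemma real_deriv_of_within {H : ℂ → ℂ} {d : ℂ} {x : ℝ}
    (h : HasDerivWithinAt H d (closure UHP) x) : HasDerivAt (fun u : ℝ => H u) d x := by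
  have h1 := h.hasFDerivWithinAt.restrictScalars ℝ
  have h2 : HasFDerivWithinAt (fun u : ℝ => (u : ℂ)) Complex.ofRealCLM univ x :=
    Complex.ofRealCLM.hasFDerivAt.hasFDerivWithinAt
  have h3 := (h1.comp x h2 (fun u _ => real_mem_cUHP u)).hasFDerivAt univ_mem
  have h4 := h3.hasDerivAt
  have e : HasDerivAt (H ∘ ofReal) d x := by simpa using h4
  exact e

lemma re_nonpos_of_im_le {H : ℂ → ℂ} {d : ℂ} {x : ℝ}
    (h : HasDerivWithinAt H d (closure UHP) x) (hle : ∀ z ∈ UHP, (H z).im ≤ (H x).im) :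
    d.re ≤ 0 := by
  have h1 := h.hasFDerivWithinAt.restrictScalars ℝ
  have e0 : (x : ℂ) + ((0 : ℝ) : ℂ) * I = x := by simp
  have h2 : HasDerivWithinAt (fun τ : ℝ => (x : ℂ) + τ * I) I (Ioi 0) 0 := by
    have : HasDerivAt (fun τ : ℝ => (x : ℂ) + τ * I) I 0 := by
      simpa using ((Complex.ofRealCLM.hasDerivAt (x := (0 : ℝ))).mul_const I).const_add (x : ℂ)
    exact this.hasDerivWithinAt
  rw [← e0] at h1
  have h3 := h1.comp_hasDerivWithinAt 0 h2 (by
    intro τ hτ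
    have : 0 < τ := hτ
    rw [mem_cUHP]; simp; linarith)
  have h4 := (Complex.imCLM.hasFDerivAt.comp_hasDerivWithinAt 0 h3)
  rw [hasDerivWithinAt_iff_tendsto_slope' (by simp)] at h4
  have h6 := le_of_tendsto h4 (b := 0) (by
    filter_upwards [self_mem_nhdsWithin] with τ hτ
    have hτ' : 0 < τ := hτ
    rw [slope_def_field]
    apply div_nonpos_of_nonpos_of_nonneg _ (by linarith)
    have := hle (x + τ * I) (by rw [mem_UHP]; simpa using hτ')
    simp only [Function.comp_apply, e0, Complex.imCLM_apply]
    linarith)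
  simpa using h6

lemma exp_Lg {w : ℂ} (h : w ≠ 0) : Complex.exp (Lg w) = w := by
  have h1 : -I * w ≠ 0 := mul_ne_zero (by simp) h
  have e : I * ((Real.pi / 2 : ℝ) : ℂ) = Real.pi / 2 * I := by push_cast; ring
  rw [Lg, Complex.exp_add, Complex.exp_log h1, e, Complex.exp_pi_div_two_mul_I]
  have := Complex.I_mul_I
  linear_combination (-w) * this

/-- A holomorphic square root of `∏ (w - y j)` on the closed upper half-plane off the nodes. -/
def SS (n : ℕ) (y : ℕ → ℝ) (w : ℂ) : ℂ :=
  Complex.exp ((∑ j ∈ Finset.Icc 1 n, Lg (w - y j)) / 2)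

lemma SS_ne (n : ℕ) (y : ℕ → ℝ) (w : ℂ) : SS n y w ≠ 0 := Complex.exp_ne_zero _

lemma SS_diff {n : ℕ} {y : ℕ → ℝ} {w : ℂ} (h : 0 ≤ w.im)
    (hw : ∀ j, 1 ≤ j → j ≤ n → w ≠ y j) : DifferentiableAt ℂ (SS n y) w := by
  unfold SS
  apply DifferentiableAt.cexp
  apply DifferentiableAt.div_const
  apply DifferentiableAt.fun_sum
  intro j hj
  rw [Finset.mem_Icc] at hj
  exact (Lg_sub_hasDerivAt h (hw j hj.1 hj.2)).differentiableAt

lemma SS_sq {n : ℕ} {y : ℕ → ℝ} {w : ℂ} (hw : ∀ j, 1 ≤ j → j ≤ n → w ≠ y j) :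
    SS n y w ^ 2 = ∏ j ∈ Finset.Icc 1 n, (w - y j) := by
  rw [SS, ← Complex.exp_nat_mul]
  have : ((2 : ℕ) : ℂ) * ((∑ j ∈ Finset.Icc 1 n, Lg (w - y j)) / 2)
      = ∑ j ∈ Finset.Icc 1 n, Lg (w - y j) := by push_cast; ring
  rw [this, Complex.exp_sum]
  apply Finset.prod_congr rfl
  intro j hj
  rw [Finset.mem_Icc] at hj
  exact exp_Lg (sub_ne_zero.2 (hw j hj.1 hj.2))

lemma ne_real_of_UHP {w : ℂ} (hw : w ∈ UHP) (a : ℝ) : w ≠ a := by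
  rintro rfl
  simp [mem_UHP] at hw

lemma SS_diffOn (n : ℕ) (y : ℕ → ℝ) : DifferentiableOn ℂ (SS n y) UHP := fun _ hw =>
  (SS_diff (le_of_lt hw) (fun j _ _ => ne_real_of_UHP hw (y j))).differentiableWithinAt

/-- `x` lies strictly between the `k`-th and the `(k+1)`-st node. -/
def InJ (n : ℕ) (y : ℕ → ℝ) (k : ℕ) (x : ℝ) : Prop :=
  k ≤ n ∧ (∀ j, 1 ≤ j → j ≤ k → y j < x) ∧ (∀ j, k < j → j ≤ n → x < y j)

lemma InJ.ne {n k : ℕ} {y : ℕ → ℝ} {x : ℝ} (h : InJ n y k x) :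
    ∀ j, 1 ≤ j → j ≤ n → (x : ℂ) ≠ y j := by
  intro j h1 h2 h3
  have h3 : x = y j := by exact_mod_cast h3
  rcases le_or_gt j k with h4 | h4
  · exact (h.2.1 j h1 h4).ne' h3
  · exact (h.2.2 j h4 h2).ne h3

lemma prod_sign {n k : ℕ} {y : ℕ → ℝ} {x : ℝ} (h : InJ n y k x) :
    ∃ c : ℝ, 0 < c ∧ ∏ j ∈ Finset.Icc 1 n, (x - y j) = (-1) ^ (n - k) * c := by
  refine ⟨∏ j ∈ Finset.Icc 1 n, |x - y j|, ?_, ?_⟩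
  · apply Finset.prod_pos
    intro j hj
    rw [Finset.mem_Icc] at hj
    have := h.ne j hj.1 hj.2
    have h3 : x ≠ y j := by exact_mod_cast this
    exact abs_pos.2 (sub_ne_zero.2 h3)
  · have h1 : ((-1 : ℝ)) ^ (n - k) = ∏ j ∈ Finset.Icc 1 n, (if j ≤ k then (1 : ℝ) else -1) := by
      rw [Finset.prod_ite, Finset.prod_const_one, one_mul, Finset.prod_const]
      congr 1
      have : Finset.filter (fun j => ¬ j ≤ k) (Finset.Icc 1 n) = Finset.Ioc k n := by
        ext j
        simp only [Finset.mem_filter, Finset.mem_Icc, Finset.mem_Ioc]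
        omega
      rw [this, Nat.card_Ioc]
    rw [h1, ← Finset.prod_mul_distrib]
    apply Finset.prod_congr rfl
    intro j hj
    rw [Finset.mem_Icc] at hj
    split_ifs with h2
    · rw [abs_of_pos (sub_pos.2 (h.2.1 j hj.1 h2)), one_mul]
    · rw [abs_of_neg (sub_neg.2 (h.2.2 j (by omega) hj.2))]
      ring

lemma SS_real {n k : ℕ} {y : ℕ → ℝ} {x : ℝ} (h : InJ n y k x) :
    (Even (n - k) → (SS n y x).im = 0) ∧ (Odd (n - k) → (SS n y x).re = 0) := by
  obtain ⟨c, hc, h1⟩ := prod_sign h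
  have h2 := SS_sq h.ne
  have h3 : (∏ j ∈ Finset.Icc 1 n, ((x : ℂ) - y j)) = (((-1) ^ (n - k) * c : ℝ) : ℂ) := by
    rw [← h1]; push_cast; rfl
  rw [h3] at h2
  have hre := congrArg Complex.re h2
  have him := congrArg Complex.im h2
  simp only [pow_two, Complex.mul_re, Complex.mul_im, Complex.ofReal_re, Complex.ofReal_im] at hre him
  set a := (SS n y x).re
  set b := (SS n y x).im
  have hab : a = 0 ∨ b = 0 := by
    have : a * b = 0 := by linarith
    exact mul_eq_zero.1 this
  constructor
  · intro he
    rw [he.neg_one_pow] at hre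
    rcases hab with h0 | h0
    · rw [h0] at hre
      nlinarith [mul_self_nonneg b]
    · exact h0
  · intro he
    rw [he.neg_one_pow] at hre
    rcases hab with h0 | h0
    · exact h0
    · rw [h0] at hre
      nlinarith [mul_self_nonneg a]

lemma exists_InJ {n : ℕ} {y : ℕ → ℝ}
    (hy : ∀ i j : ℕ, 1 ≤ i → i < j → j ≤ n → y i < y j) (x : ℝ) :
    (∃ j, 1 ≤ j ∧ j ≤ n ∧ x = y j) ∨ ∃ k, InJ n y k x := by
  classical
  set P : ℕ → Prop := fun j => j = 0 ∨ y j ≤ x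
  set k := Nat.findGreatest P n with hk
  have hkn : k ≤ n := Nat.findGreatest_le n
  have hPk : P k := Nat.findGreatest_spec (P := P) (Nat.zero_le n) (Or.inl rfl)
  by_cases hx : 1 ≤ k ∧ x = y k
  · exact Or.inl ⟨k, hx.1, hkn, hx.2⟩
  · refine Or.inr ⟨k, hkn, ?_, ?_⟩
    · intro j h1 h2
      have h3 : y k ≤ x := by
        rcases hPk with h | h
        · omega
        · exact h
      have h4 : y k < x := lt_of_le_of_ne h3 (fun h => hx ⟨by omega, h.symm⟩)
      rcases Nat.lt_or_ge j k with h5 | h5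
      · exact (hy j k h1 h5 hkn).trans h4
      · have : j = k := le_antisymm h2 h5
        rwa [this]
    · intro j h1 h2
      have := Nat.findGreatest_is_greatest (P := P) (n := n) h1 h2
      by_contra h3
      exact this (Or.inr (not_lt.1 h3))

lemma pow_div_bound {n m : ℕ} {y : ℕ → ℝ}
    (hy : ∀ i j : ℕ, 1 ≤ i → i < j → j ≤ n → y i < y j) (hm : m < n) :
    ∃ C : ℝ, 0 ≤ C ∧ ∀ w ∈ UHP, ‖w ^ m / ∏ j ∈ Finset.Icc 1 n, (w - y j)‖ ≤ C / w.im := by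
  have hinj : Set.InjOn (fun j => (y j : ℂ)) (Finset.Icc 1 n : Finset ℕ) := by
    intro i hi j hj hij
    have hij : y i = y j := Complex.ofReal_injective hij
    simp only [Finset.coe_Icc, Set.mem_Icc] at hi hj
    rcases lt_trichotomy i j with h | h | h
    · exact absurd hij (hy i j hi.1 h hj.2).ne
    · exact h
    · exact absurd hij (hy j i hj.1 h hi.2).ne'
  set v : ℕ → ℂ := fun j => (y j : ℂ) with hv
  set s := Finset.Icc 1 n with hs
  refine ⟨∑ i ∈ s, ‖Lagrange.nodalWeight s v i * v i ^ m‖, by positivity, ?_⟩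
  intro w hw
  have hwim : 0 < w.im := hw
  have h1 : (Polynomial.X ^ m : Polynomial ℂ) = Lagrange.interpolate s v (fun i => v i ^ m) := by
    have := Lagrange.eq_interpolate (f := (Polynomial.X ^ m : Polynomial ℂ)) hinj
      (by rw [Polynomial.degree_X_pow, hs, Nat.card_Icc]; simpa using hm)
    simpa using this
  have h2 := congrArg (Polynomial.eval w) h1
  rw [Lagrange.eval_interpolate_not_at_node _ (fun i _ => ne_real_of_UHP hw (y i)),
    Lagrange.eval_nodal] at h2
  have h3 : ∏ j ∈ s, (w - y j) ≠ 0 :=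
    Finset.prod_ne_zero_iff.2 (fun i _ => sub_ne_zero.2 (ne_real_of_UHP hw (y i)))
  have h4 : w ^ m / ∏ j ∈ s, (w - y j) =
      ∑ i ∈ s, Lagrange.nodalWeight s v i * (w - v i)⁻¹ * v i ^ m := by
    rw [div_eq_iff h3, mul_comm]
    simpa using h2
  rw [h4, Finset.sum_div]
  apply norm_sum_le_of_le
  intro i _
  rw [mul_right_comm, norm_mul, norm_inv, div_eq_mul_inv]
  apply mul_le_mul_of_nonneg_left _ (norm_nonneg _)
  apply inv_anti₀ hwim
  have := Complex.abs_im_le_norm (w - v i)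
  have h5 := le_abs_self (w - v i).im
  simp only [hv, Complex.sub_im, Complex.ofReal_im, sub_zero] at this h5 ⊢
  linarith

lemma pow_div_SS_bound {N k : ℕ} {y : ℕ → ℝ}
    (hy : ∀ i j : ℕ, 1 ≤ i → i < j → j ≤ 2 * N → y i < y j) (hk : k < N) :
    ∃ C : ℝ, 0 ≤ C ∧ ∀ w ∈ UHP, ‖w ^ k / SS (2 * N) y w‖ ≤ C * (1 / √w.im) := by
  obtain ⟨C, hC, h⟩ := pow_div_bound hy (m := 2 * k) (by omega)
  refine ⟨√C, Real.sqrt_nonneg _, ?_⟩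
  intro w hw
  have h1 := h w hw
  rw [← SS_sq (fun j _ _ => ne_real_of_UHP hw (y j)), mul_comm 2 k, pow_mul, ← div_pow,
    norm_pow] at h1
  rw [mul_one_div, ← Real.sqrt_div hC]
  exact Real.le_sqrt_of_sq_le h1

lemma pow_div_SS_bound' {N k : ℕ} {y : ℕ → ℝ}
    (hy : ∀ i j : ℕ, 1 ≤ i → i < j → j ≤ 2 * N → y i < y j) (hk : k + 1 < N) :
    ∃ C : ℝ, 0 ≤ C ∧ ∀ w ∈ UHP, ‖w ^ k / SS (2 * N) y w‖ ≤ C * (1 / (√w.im * (1 + ‖w‖))) := by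
  obtain ⟨C, hC, h⟩ := pow_div_SS_bound hy (k := k) (by omega)
  obtain ⟨D, hD, h'⟩ := pow_div_SS_bound hy (k := k + 1) (by omega)
  refine ⟨C + D, by positivity, ?_⟩
  intro w hw
  have h1 := h w hw
  have h2 := h' w hw
  have h0 : 0 < √w.im := Real.sqrt_pos.2 hw
  rw [← div_div, mul_div_assoc', le_div_iff₀ (by positivity)]
  have e : ‖w ^ (k + 1) / SS (2 * N) y w‖ = ‖w ^ k / SS (2 * N) y w‖ * ‖w‖ := by
    rw [← norm_mul]; congr 1; ring
  rw [e] at h2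
  linarith

lemma const_of_zero {f : ℝ → ℝ} {a b : ℝ} (hc : ContinuousOn f (Icc a b))
    (hd : ∀ x ∈ Ioo a b, HasDerivAt f 0 x) : ∀ x ∈ Icc a b, f x = f a := by
  intro x hx
  rcases hx.1.eq_or_lt with h | h
  · rw [h]
  · obtain ⟨c, -, h1⟩ := exists_hasDerivAt_eq_slope f (fun _ => 0) h
      (hc.mono (Icc_subset_Icc le_rfl hx.2)) (fun u hu => hd u ⟨hu.1, hu.2.trans_le hx.2⟩)
    have h2 : x - a ≠ 0 := (sub_pos.2 h).ne'
    rw [eq_comm, div_eq_zero_iff] at h1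
    rcases h1 with h1 | h1
    · linarith
    · exact absurd h1 h2

lemma hasDerivAt_re {E : ℝ → ℂ} {d : ℂ} {x : ℝ} (h : HasDerivAt E d x) :
    HasDerivAt (fun u => (E u).re) d.re x :=
  (Complex.reCLM.hasFDerivAt.comp_hasDerivAt x h)

lemma hasDerivAt_im {E : ℝ → ℂ} {d : ℂ} {x : ℝ} (h : HasDerivAt E d x) :
    HasDerivAt (fun u => (E u).im) d.im x :=
  (Complex.imCLM.hasFDerivAt.comp_hasDerivAt x h)

structure Nice (N : ℕ) (y : ℕ → ℝ) (t s : ℝ) (E φ : ℂ → ℂ) : Prop where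
  cont : ContinuousOn E (closure UHP \ {(t : ℂ), (s : ℂ)})
  bdd : ∃ M : ℝ, ∀ z ∈ UHP, |(E z).im| ≤ M
  der : ∀ z ∈ UHP, HasDerivAt E (φ z) z
  bder : ∀ (k : ℕ) (x : ℝ), InJ (2 * N) y k x → x ≠ t → x ≠ s →
    HasDerivWithinAt E (φ x) (closure UHP) x
  ev : ∀ (k : ℕ) (x : ℝ), InJ (2 * N) y k x → x ≠ t → x ≠ s → Even k → (φ x).re = 0
  od : ∀ (k : ℕ) (x : ℝ), InJ (2 * N) y k x → x ≠ t → x ≠ s → Odd k → (φ x).im = 0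
  top : Tendsto (fun x : ℝ => (E x).re) atTop (𝓝 0)
  bot : Tendsto (fun x : ℝ => (E x).re) atBot (𝓝 0)

lemma Nice.add {N : ℕ} {y : ℕ → ℝ} {t s : ℝ} {E φ F ψ : ℂ → ℂ} (h : Nice N y t s E φ)
    (g : Nice N y t s F ψ) : Nice N y t s (fun z => E z + F z) (fun z => φ z + ψ z) where
  cont := h.cont.add g.cont
  bdd := by
    obtain ⟨M, hM⟩ := h.bdd
    obtain ⟨L, hL⟩ := g.bdd
    refine ⟨M + L, fun z hz => ?_⟩
    rw [Complex.add_im]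
    exact (abs_add_le _ _).trans (add_le_add (hM z hz) (hL z hz))
  der := fun z hz => (h.der z hz).add (g.der z hz)
  bder := fun k x hx h1 h2 => (h.bder k x hx h1 h2).add (g.bder k x hx h1 h2)
  ev := fun k x hx h1 h2 h3 => by
    rw [Complex.add_re, h.ev k x hx h1 h2 h3, g.ev k x hx h1 h2 h3, add_zero]
  od := fun k x hx h1 h2 h3 => by
    rw [Complex.add_im, h.od k x hx h1 h2 h3, g.od k x hx h1 h2 h3, add_zero]
  top := by simpa using h.top.add g.top
  bot := by simpa using h.bot.add g.bot

lemma Nice.smul {N : ℕ} {y : ℕ → ℝ} {t s : ℝ} {E φ : ℂ → ℂ} (h : Nice N y t s E φ)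
    (c : ℝ) : Nice N y t s (fun z => (c : ℂ) * E z) (fun z => (c : ℂ) * φ z) where
  cont := h.cont.const_mul _
  bdd := by
    obtain ⟨M, hM⟩ := h.bdd
    refine ⟨|c| * M, fun z hz => ?_⟩
    rw [Complex.im_ofReal_mul, abs_mul]
    exact mul_le_mul_of_nonneg_left (hM z hz) (abs_nonneg c)
  der := fun z hz => (h.der z hz).const_mul _
  bder := fun k x hx h1 h2 => (h.bder k x hx h1 h2).const_mul _
  ev := fun k x hx h1 h2 h3 => by
    rw [Complex.re_ofReal_mul, h.ev k x hx h1 h2 h3, mul_zero]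
  od := fun k x hx h1 h2 h3 => by
    rw [Complex.im_ofReal_mul, h.od k x hx h1 h2 h3, mul_zero]
  top := by simpa using h.top.const_mul c
  bot := by simpa using h.bot.const_mul c

lemma Nice.const (N : ℕ) (y : ℕ → ℝ) (t s : ℝ) (α : ℝ) :
    Nice N y t s (fun _ => I * α) (fun _ => 0) where
  cont := continuousOn_const
  bdd := ⟨|α|, fun z _ => by simp⟩
  der := fun z hz => hasDerivAt_const _ _
  bder := fun k x hx h1 h2 => hasDerivWithinAt_const _ _ _
  ev := fun k x hx h1 h2 h3 => by simp
  od := fun k x hx h1 h2 h3 => by simp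
  top := by simp
  bot := by simp

lemma Nice.sum {ι : Type*} (A : Finset ι) {N : ℕ} {y : ℕ → ℝ} {t s : ℝ} {E φ : ι → ℂ → ℂ}
    (h : ∀ i ∈ A, Nice N y t s (E i) (φ i)) :
    Nice N y t s (fun z => ∑ i ∈ A, E i z) (fun z => ∑ i ∈ A, φ i z) := by
  classical
  induction A using Finset.induction_on with
  | empty => simpa using Nice.const N y t s 0
  | insert a A ha ih =>
    simp only [Finset.sum_insert ha]
    exact (h a (Finset.mem_insert_self _ _)).add
      (ih (fun i hi => h i (Finset.mem_insert_of_mem hi)))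

lemma InJ_of_Ioo {n k : ℕ} {y : ℕ → ℝ} {x : ℝ}
    (hy : ∀ i j : ℕ, 1 ≤ i → i < j → j ≤ n → y i < y j) (hk : 1 ≤ k) (hk' : k + 1 ≤ n)
    (hx : x ∈ Ioo (y k) (y (k + 1))) : InJ n y k x := by
  refine ⟨by omega, fun j h1 h2 => ?_, fun j h1 h2 => ?_⟩
  · rcases h2.eq_or_lt with h | h
    · rw [h]; exact hx.1
    · exact (hy j k h1 h (by omega)).trans hx.1
  · rcases (Nat.succ_le_of_lt h1).eq_or_lt with h | h
    · rw [← h]; exact hx.2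
    · exact hx.2.trans (hy (k + 1) j (by omega) h h2)

lemma InJ_zero {n : ℕ} {y : ℕ → ℝ} {x : ℝ}
    (hy : ∀ i j : ℕ, 1 ≤ i → i < j → j ≤ n → y i < y j) (hx : x < y 1) : InJ n y 0 x := by
  refine ⟨by omega, fun j h1 h2 => by omega, fun j h1 h2 => ?_⟩
  rcases (Nat.succ_le_of_lt h1).eq_or_lt with h | h
  · rw [← h]; exact hx
  · exact hx.trans (hy 1 j le_rfl h h2)

lemma InJ_last {n : ℕ} {y : ℕ → ℝ} {x : ℝ}
    (hy : ∀ i j : ℕ, 1 ≤ i → i < j → j ≤ n → y i < y j) (hx : y n < x) : InJ n y n x := by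
  refine ⟨le_rfl, fun j h1 h2 => ?_, fun j h1 h2 => by omega⟩
  rcases h2.eq_or_lt with h | h
  · rw [h]; exact hx
  · exact (hy j n h1 h le_rfl).trans hx

lemma InJ_unique {n k l : ℕ} {y : ℕ → ℝ} {x : ℝ} (h : InJ n y k x) (h' : InJ n y l x) : k = l := by
  rcases lt_trichotomy k l with h1 | h1 | h1
  · have := h'.2.1 l (by omega) le_rfl
    have := h.2.2 l h1 h'.1
    linarith
  · exact h1
  · have := h.2.1 k (by omega) le_rfl
    have := h'.2.2 k h1 h.1
    linarith

lemma InJ_open {n k : ℕ} {y : ℕ → ℝ} {p : ℝ} (h : InJ n y k p) :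
    ∃ r > 0, ∀ x, |x - p| ≤ r → InJ n y k x := by
  have h1 : ∀ᶠ x in 𝓝 p, ∀ j ∈ Finset.Icc 1 k, y j < x := by
    rw [Filter.eventually_all_finset]
    intro j hj
    rw [Finset.mem_Icc] at hj
    exact lt_mem_nhds (h.2.1 j hj.1 hj.2)
  have h2 : ∀ᶠ x in 𝓝 p, ∀ j ∈ Finset.Ioc k n, x < y j := by
    rw [Filter.eventually_all_finset]
    intro j hj
    rw [Finset.mem_Ioc] at hj
    exact gt_mem_nhds (h.2.2 j hj.1 hj.2)
  obtain ⟨r, hr, h3⟩ := Metric.eventually_nhds_iff.1 (h1.and h2)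
  refine ⟨r / 2, by positivity, fun x hx => ?_⟩
  have h4 := h3 (y := x) (by rw [Real.dist_eq]; linarith)
  exact ⟨h.1, fun j a b => h4.1 j (Finset.mem_Icc.2 ⟨a, b⟩),
    fun j a b => h4.2 j (Finset.mem_Ioc.2 ⟨a, b⟩)⟩

section cons
variable {N : ℕ} {y : ℕ → ℝ} {t s : ℝ} {E φ : ℂ → ℂ}

lemma Nice.contReal (h : Nice N y t s E φ) {a b : ℝ} (hts : ∀ x ∈ Icc a b, x ≠ t ∧ x ≠ s) :
    ContinuousOn (fun u : ℝ => E u) (Icc a b) := by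
  apply h.cont.comp (by fun_prop)
  intro x hx
  exact real_mem_diff (hts x hx).1 (hts x hx).2

lemma Nice.re_const (h : Nice N y t s E φ) {a b : ℝ} (hts : ∀ x ∈ Icc a b, x ≠ t ∧ x ≠ s)
    (hI : ∀ x ∈ Ioo a b, ∃ k, InJ (2 * N) y k x ∧ Even k) :
    ∀ x ∈ Icc a b, (E x).re = (E a).re := by
  apply const_of_zero (f := fun u : ℝ => (E u).re)
  · exact Complex.continuous_re.comp_continuousOn (h.contReal hts)
  · intro x hx
    obtain ⟨k, hk, he⟩ := hI x hx
    have h1 := hts x (Ioo_subset_Icc_self hx)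
    have h2 := hasDerivAt_re (real_deriv_of_within (h.bder k x hk h1.1 h1.2))
    rwa [h.ev k x hk h1.1 h1.2 he] at h2

lemma Nice.im_const (h : Nice N y t s E φ) {a b : ℝ} (hts : ∀ x ∈ Icc a b, x ≠ t ∧ x ≠ s)
    (hI : ∀ x ∈ Ioo a b, ∃ k, InJ (2 * N) y k x ∧ Odd k) :
    ∀ x ∈ Icc a b, (E x).im = (E a).im := by
  apply const_of_zero (f := fun u : ℝ => (E u).im)
  · exact Complex.continuous_im.comp_continuousOn (h.contReal hts)
  · intro x hx
    obtain ⟨k, hk, he⟩ := hI x hx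
    have h1 := hts x (Ioo_subset_Icc_self hx)
    have h2 := hasDerivAt_im (real_deriv_of_within (h.bder k x hk h1.1 h1.2))
    rwa [h.od k x hk h1.1 h1.2 he] at h2

lemma Nice.tendsto (h : Nice N y t s E φ) {x : ℝ} (h1 : x ≠ t) (h2 : x ≠ s) :
    Tendsto E (𝓝[UHP] (x : ℂ)) (𝓝 (E x)) :=
  (h.cont x (real_mem_diff h1 h2)).mono (UHP_subset_diff t s)

lemma Nice.tendsto_re (h : Nice N y t s E φ) {x : ℝ} (h1 : x ≠ t) (h2 : x ≠ s) :
    Tendsto (fun z => (E z).re) (𝓝[UHP] (x : ℂ)) (𝓝 (E x).re) :=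
  (Complex.continuous_re.tendsto _).comp (h.tendsto h1 h2)

lemma Nice.tendsto_im (h : Nice N y t s E φ) {x : ℝ} (h1 : x ≠ t) (h2 : x ≠ s) :
    Tendsto (fun z => (E z).im) (𝓝[UHP] (x : ℂ)) (𝓝 (E x).im) :=
  (Complex.continuous_im.tendsto _).comp (h.tendsto h1 h2)

lemma InJ_one (hN : 2 ≤ N) (hy : ∀ i j : ℕ, 1 ≤ i → i < j → j ≤ 2 * N → y i < y j)
    {x : ℝ} (h1 : y 1 < x) (h2 : x < y 2) : InJ (2 * N) y 1 x :=
  InJ_of_Ioo hy le_rfl (by omega) ⟨h1, h2⟩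

lemma Nice.left_zero (h : Nice N y t s E φ)
    (hy : ∀ i j : ℕ, 1 ≤ i → i < j → j ≤ 2 * N → y i < y j)
    (ht : y 1 < t) (hts : t < s) {x : ℝ} (hx : x ≤ y 1) : (E x).re = 0 := by
  have h1 : ∀ u ≤ x, (E u).re = (E x).re := by
    intro u hu
    refine (h.re_const (a := u) (b := x) (fun z hz => ?_) (fun z hz => ?_) x ⟨hu, le_rfl⟩).symm
    · exact ⟨by linarith [hz.2] |> fun (a : z < t) => a.ne, by linarith [hz.2] |> fun (a : z < s) => a.ne⟩
    · exact ⟨0, InJ_zero hy (hz.2.trans_le hx), Even.zero⟩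
  have h2 : Tendsto (fun u : ℝ => (E u).re) atBot (𝓝 (E x).re) := by
    refine tendsto_const_nhds.congr' ?_
    filter_upwards [eventually_le_atBot x] with u hu
    exact (h1 u hu).symm
  exact tendsto_nhds_unique h2 h.bot

lemma Nice.right_zero (h : Nice N y t s E φ) (hN : 2 ≤ N)
    (hy : ∀ i j : ℕ, 1 ≤ i → i < j → j ≤ 2 * N → y i < y j)
    (hts : t < s) (hs : s < y 2) {x : ℝ} (hx : y (2 * N) ≤ x) : (E x).re = 0 := by
  have h0 := hy 2 (2 * N) (by omega) (by omega) le_rfl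
  have h1 : ∀ u ≥ x, (E u).re = (E x).re := by
    intro u hu
    refine (h.re_const (a := x) (b := u) (fun z hz => ?_) (fun z hz => ?_) u ⟨hu, le_rfl⟩)
    · exact ⟨by linarith [hz.1] |> fun (a : t < z) => a.ne', by linarith [hz.1] |> fun (a : s < z) => a.ne'⟩
    · exact ⟨2 * N, InJ_last hy (hx.trans_lt hz.1), even_two_mul N⟩
  have h2 : Tendsto (fun u : ℝ => (E u).re) atTop (𝓝 (E x).re) := by
    refine tendsto_const_nhds.congr' ?_
    filter_upwards [eventually_ge_atTop x] with u hu
    exact (h1 u hu).symm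
  exact tendsto_nhds_unique h2 h.top

lemma Nice.gap (h : Nice N y t s E φ)
    (hy : ∀ i j : ℕ, 1 ≤ i → i < j → j ≤ 2 * N → y i < y j)
    (hts : t < s) (hs : s < y 2) {i : ℕ} (h1 : 1 ≤ i) (h2 : i ≤ N - 1) :
    ∀ x ∈ Icc (y (2 * i)) (y (2 * i + 1)), (E x).re = (E (y (2 * i))).re := by
  have h0 : y 2 ≤ y (2 * i) := by
    rcases h1.eq_or_lt with h3 | h3
    · rw [← h3]
    · exact (hy 2 (2 * i) (by omega) (by omega) (by omega)).le
  refine h.re_const (fun z hz => ?_) (fun z hz => ?_)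
  · exact ⟨by linarith [hz.1] |> fun (a : t < z) => a.ne', by linarith [hz.1] |> fun (a : s < z) => a.ne'⟩
  · exact ⟨2 * i, InJ_of_Ioo hy (by omega) (by omega) hz, even_two_mul i⟩

lemma Nice.int (h : Nice N y t s E φ)
    (hy : ∀ i j : ℕ, 1 ≤ i → i < j → j ≤ 2 * N → y i < y j)
    {i : ℕ} (h1 : 1 ≤ i) (h2 : i ≤ N)
    (h3 : ∀ x ∈ Icc (y (2 * i - 1)) (y (2 * i)), x ≠ t ∧ x ≠ s) :
    ∀ x ∈ Icc (y (2 * i - 1)) (y (2 * i)), (E x).im = (E (y (2 * i))).im := by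
  have h4 := hy (2 * i - 1) (2 * i) (by omega) (by omega) (by omega)
  have key := h.im_const h3 (fun z hz => ⟨2 * i - 1, InJ_of_Ioo hy (by omega) (by omega)
    (by rwa [Nat.sub_add_cancel (by omega)]), ⟨i - 1, by omega⟩⟩)
  intro x hx
  rw [key x hx, key (y (2 * i)) ⟨h4.le, le_rfl⟩]

lemma Nice.loc (h : Nice N y t s E φ) (hN : 2 ≤ N)
    (hy : ∀ i j : ℕ, 1 ≤ i → i < j → j ≤ 2 * N → y i < y j)
    (ht : y 1 < t) (hts : t < s) (hs : s < y 2) {k : ℕ} {p : ℝ} (hp : InJ (2 * N) y k p)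
    (hk : Even k) : ∃ r > 0, ∃ c : ℝ, ∀ x : ℝ, |x - p| < r →
      Tendsto (fun z => (E z).re) (𝓝[UHP] (x : ℂ)) (𝓝 c) := by
  obtain ⟨r, hr, h1⟩ := InJ_open hp
  have hne : ∀ x, |x - p| ≤ r → x ≠ t ∧ x ≠ s := by
    intro x hx
    have h2 := h1 x hx
    have hk1 : k ≠ 1 := by rintro rfl; exact absurd hk (by decide)
    constructor
    · rintro rfl
      exact hk1 (InJ_unique h2 (InJ_one hN hy ht (hts.trans hs)))
    · rintro rfl
      exact hk1 (InJ_unique h2 (InJ_one hN hy (ht.trans hts) hs))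
  refine ⟨r, hr, (E ((p - r : ℝ) : ℂ)).re, fun x hx => ?_⟩
  have h2 : (E x).re = (E ((p - r : ℝ) : ℂ)).re := by
    refine h.re_const (a := p - r) (b := p + r) (fun z hz => hne z ?_) (fun z hz => ⟨k, h1 z ?_, hk⟩) x ?_
    · rw [abs_le]; constructor <;> linarith [hz.1, hz.2]
    · rw [abs_le]; constructor <;> linarith [hz.1, hz.2]
    · rw [abs_lt] at hx; constructor <;> linarith [hx.1, hx.2]
  rw [← h2]
  exact h.tendsto_re (hne x hx.le).1 (hne x hx.le).2

lemma cover (hN : 2 ≤ N) (hy : ∀ i j : ℕ, 1 ≤ i → i < j → j ≤ 2 * N → y i < y j) (p : ℝ) :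
    (∃ i, 1 ≤ i ∧ i ≤ N ∧ p ∈ Icc (y (2 * i - 1)) (y (2 * i))) ∨
      ∃ k, InJ (2 * N) y k p ∧ Even k := by
  rcases exists_InJ hy p with ⟨j, h1, h2, h3⟩ | ⟨k, hk⟩
  · left
    rcases Nat.even_or_odd j with ⟨i, hi⟩ | ⟨i, hi⟩
    · have h4 := hy (2 * i - 1) (2 * i) (by omega) (by omega) (by omega)
      refine ⟨i, by omega, by omega, ?_⟩
      have : j = 2 * i := by omega
      rw [h3, this]
      exact ⟨h4.le, le_rfl⟩
    · have h4 := hy (2 * i + 1) (2 * i + 2) (by omega) (by omega) (by omega)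
      refine ⟨i + 1, by omega, by omega, ?_⟩
      have e : 2 * (i + 1) - 1 = 2 * i + 1 := by omega
      rw [h3, hi, e]
      exact ⟨le_rfl, h4.le⟩
  · rcases Nat.even_or_odd k with he | ⟨i, hi⟩
    · exact Or.inr ⟨k, hk, he⟩
    · left
      have h5 := hk.1
      refine ⟨i + 1, by omega, by omega, ?_⟩
      have e : 2 * (i + 1) - 1 = 2 * i + 1 := by omega
      rw [e]
      exact ⟨(hk.2.1 _ (by omega) (by omega)).le, (hk.2.2 _ (by omega) (by omega)).le⟩

lemma maxp {f : ℂ → ℂ} {v : ℂ → ℝ} {M B : ℝ} (hN : 2 ≤ N)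
    (hy : ∀ i j : ℕ, 1 ≤ i → i < j → j ≤ 2 * N → y i < y j)
    (ht : y 1 < t) (hts : t < s)
    (hf : DifferentiableOn ℂ f UHP) (hv : ∀ z ∈ UHP, v z = (f z).im)
    (hvc : ContinuousOn v (closure UHP \ {(t : ℂ), (s : ℂ)})) (hM0 : ∀ z ∈ UHP, v z ≤ M)
    (hodd : ∀ i, 1 ≤ i → i ≤ N → ∀ x ∈ Icc (y (2 * i - 1)) (y (2 * i)), x ≠ t → x ≠ s → v x ≤ B)
    (hev : ∀ k p, InJ (2 * N) y k p → Even k → ∃ r > 0, ∃ c : ℝ, ∀ x : ℝ, |x - p| < r →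
      Tendsto (fun z => (f z).re) (𝓝[UHP] (x : ℂ)) (𝓝 c)) : ∀ z ∈ UHP, v z ≤ B := by
  have h12 := hy 1 2 le_rfl (by omega) (by omega)
  refine max_principle (a := y 1) ht.ne (ht.trans hts).ne hf hv hvc hM0
    (hodd 1 le_rfl (by omega) (y 1) ⟨le_rfl, h12.le⟩ ht.ne (ht.trans hts).ne) ?_
  intro p hp1 hp2
  rcases cover hN hy p with ⟨i, h1, h2, h3⟩ | ⟨k, hk, he⟩
  · exact Or.inl (hodd i h1 h2 p h3 hp1 hp2)
  · exact Or.inr (hev k p hk he)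

end cons

lemma deriv_zero_of_im {f : ℂ → ℂ} (h : ∀ z ∈ UHP, (f z).im = 0) {z d : ℂ} (hz : z ∈ UHP)
    (hd : HasDerivAt f d z) : d = 0 := by
  have key : ∀ c : ℂ, (d * c).im = 0 := by
    intro c
    have h0 : z + ((0 : ℝ) : ℂ) * c = z := by simp
    have h1 : HasDerivAt (fun u : ℝ => z + u * c) c 0 := by
      simpa using ((Complex.ofRealCLM.hasDerivAt (x := (0 : ℝ))).mul_const c).const_add z
    have hd' : HasDerivAt f d (z + ((0 : ℝ) : ℂ) * c) := by rwa [h0]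
    have h2 := hasDerivAt_im (hd'.comp (0 : ℝ) h1)
    have h3 : (fun u : ℝ => ((f ∘ fun u : ℝ => z + u * c) u).im) =ᶠ[𝓝 0] fun _ => 0 := by
      have : ∀ᶠ u : ℝ in 𝓝 0, z + u * c ∈ UHP := by
        apply h1.continuousAt.eventually_mem
        rw [h0]
        exact isOpen_UHP.mem_nhds hz
      filter_upwards [this] with u hu
      exact h _ hu
    exact h2.unique ((hasDerivAt_const (0 : ℝ) (0 : ℝ)).congr_of_eventuallyEq h3)
  have h1 := key 1
  have h2 := key I
  apply Complex.ext
  · simpa using h2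
  · simpa using h1

lemma phi_cont {n k : ℕ} {y : ℕ → ℝ} {x : ℝ} (h : InJ n y k x) :
    DifferentiableAt ℂ (SS n y) (x : ℂ) := SS_diff (by simp) h.ne

lemma family_exists {N : ℕ} {y : ℕ → ℝ}
    (hy : ∀ i j : ℕ, 1 ≤ i → i < j → j ≤ 2 * N → y i < y j) :
    ∃ H : Fin (N - 1) → ℂ → ℂ, ∀ k, ∀ t s : ℝ,
      Nice N y t s (H k) (fun w => I * w ^ (k : ℕ) / SS (2 * N) y w) := by
  have key : ∀ k : Fin (N - 1), ∃ H : ℂ → ℂ, ∀ t s : ℝ,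
      Nice N y t s H (fun w => I * w ^ (k : ℕ) / SS (2 * N) y w) := by
    intro k
    have hk := k.2
    obtain ⟨C, hC, hb⟩ := pow_div_SS_bound' hy (k := k) (by omega)
    have hd : DifferentiableOn ℂ (fun w => I * w ^ (k : ℕ) / SS (2 * N) y w) UHP := by
      apply DifferentiableOn.div (by fun_prop) (SS_diffOn _ _)
      intro w _
      exact SS_ne _ _ _
    obtain ⟨H, h1, ⟨M, h2⟩, h3, h4, h5, h6⟩ := primitive_exists hC hd (by
      intro w hw
      rw [mul_div_assoc, norm_mul, Complex.norm_I, one_mul]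
      exact hb w hw)
    refine ⟨H, fun t s => ⟨h1.mono sdiff_subset, ⟨M, fun z hz => ?_⟩, h3, ?_, ?_, ?_, ?_, ?_⟩⟩
    · exact (Complex.abs_im_le_norm _).trans (h2 z (subset_closure hz))
    · intro j x hx _ _
      apply h4
      apply ContinuousAt.continuousWithinAt
      apply ContinuousAt.div (by fun_prop) (phi_cont hx).continuousAt (SS_ne _ _ _)
    · intro j x hx _ _ he
      have h7 := (SS_real hx).1 ((Nat.even_sub hx.1).2 (by simp [he]))
      have h8 : SS (2 * N) y x = ((SS (2 * N) y x).re : ℂ) := by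
        apply Complex.ext <;> simp [h7]
      rw [h8, Complex.div_ofReal_re, ← Complex.ofReal_pow, Complex.re_mul_ofReal,
        Complex.I_re, zero_mul, zero_div]
    · intro j x hx _ _ he
      have h7 := (SS_real hx).2 ((Nat.odd_sub hx.1).2
        (iff_of_false (by simp) (Nat.not_even_iff_odd.2 he)))
      have h8 : SS (2 * N) y x = I * ((SS (2 * N) y x).im : ℂ) := by
        apply Complex.ext <;> simp [h7]
      rw [h8, mul_div_mul_left _ _ Complex.I_ne_zero, ← Complex.ofReal_pow, ← Complex.ofReal_div,
        Complex.ofReal_im]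
    · exact (Complex.continuous_re.tendsto 0).comp h5
    · exact (Complex.continuous_re.tendsto 0).comp h6
  choose H hH using key
  exact ⟨H, hH⟩

/-- Linear combinations of the basic functions, plus an imaginary constant. -/
def EE {m : ℕ} (H : Fin m → ℂ → ℂ) (v : (Fin m → ℝ) × ℝ) (z : ℂ) : ℂ :=
  (∑ k, (v.1 k : ℂ) * H k z) + I * v.2

lemma EE_add {m : ℕ} (H : Fin m → ℂ → ℂ) (v w : (Fin m → ℝ) × ℝ) (z : ℂ) :
    EE H (v + w) z = EE H v z + EE H w z := by
  simp only [EE, Prod.fst_add, Prod.snd_add, Pi.add_apply, Complex.ofReal_add, add_mul,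
    Finset.sum_add_distrib, mul_add]
  ring

lemma EE_smul {m : ℕ} (H : Fin m → ℂ → ℂ) (c : ℝ) (v : (Fin m → ℝ) × ℝ) (z : ℂ) :
    EE H (c • v) z = c * EE H v z := by
  simp only [EE, Prod.smul_fst, Prod.smul_snd, Pi.smul_apply, smul_eq_mul, Complex.ofReal_mul,
    mul_add, Finset.mul_sum, mul_assoc]
  ring

lemma poly_zero {m : ℕ} (a : Fin m → ℝ) {T : Set ℂ} (hT : T.Infinite)
    (h : ∀ w ∈ T, ∑ k, (a k : ℂ) * w ^ (k : ℕ) = 0) : a = 0 := by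
  set p : Polynomial ℂ := ∑ k : Fin m, Polynomial.C (a k : ℂ) * Polynomial.X ^ (k : ℕ) with hp
  have h0 : p = 0 := by
    apply Polynomial.eq_zero_of_infinite_isRoot
    apply hT.mono
    intro w hw
    have := h w hw
    simp only [Set.mem_ofPred_eq, Polynomial.IsRoot.def, hp, Polynomial.eval_finsetSum,
      Polynomial.eval_mul, Polynomial.eval_C, Polynomial.eval_pow, Polynomial.eval_X]
    exact this
  funext k
  have h1 : p.coeff k = 0 := by rw [h0]; simp
  rw [hp, Polynomial.finsetSum_coeff] at h1
  simp only [Polynomial.coeff_C_mul, Polynomial.coeff_X_pow, mul_ite, mul_one, mul_zero] at h1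
  rw [Finset.sum_eq_single k] at h1
  · simpa using h1
  · intro b _ hb
    rw [if_neg]
    intro h
    exact hb (Fin.ext h.symm)
  · simp

section lin
variable {N : ℕ} {y : ℕ → ℝ} {t s : ℝ} {H : Fin (N - 1) → ℂ → ℂ}

lemma EE_nice (hH : ∀ k, ∀ t s : ℝ,
      Nice N y t s (H k) (fun w => I * w ^ (k : ℕ) / SS (2 * N) y w)) (v : (Fin (N - 1) → ℝ) × ℝ)
    (t s : ℝ) : Nice N y t s (EE H v)
      (fun w => (I / SS (2 * N) y w) * ∑ k, (v.1 k : ℂ) * w ^ (k : ℕ)) := by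
  have h1 := (Nice.sum Finset.univ (fun k _ => (hH k t s).smul (v.1 k))).add
    (Nice.const N y t s v.2)
  convert h1 using 2 with w
  · rfl
  rw [add_zero, Finset.mul_sum]
  apply Finset.sum_congr rfl
  intro k _
  ring

lemma coef_zero (v : (Fin (N - 1) → ℝ) × ℝ) {T : Set ℂ} (hT : T.Infinite)
    (h : ∀ w ∈ T, (I / SS (2 * N) y w) * ∑ k, (v.1 k : ℂ) * w ^ (k : ℕ) = 0) : v.1 = 0 := by
  apply poly_zero v.1 hT
  intro w hw
  rcases mul_eq_zero.1 (h w hw) with h1 | h1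
  · exact absurd h1 (div_ne_zero Complex.I_ne_zero (SS_ne _ _ _))
  · exact h1

lemma EE_int (hH : ∀ k, ∀ t s : ℝ,
      Nice N y t s (H k) (fun w => I * w ^ (k : ℕ) / SS (2 * N) y w))
    (hy : ∀ i j : ℕ, 1 ≤ i → i < j → j ≤ 2 * N → y i < y j)
    (v : (Fin (N - 1) → ℝ) × ℝ) {i : ℕ} (h1 : 1 ≤ i) (h2 : i ≤ N) :
    ∀ x ∈ Icc (y (2 * i - 1)) (y (2 * i)), (EE H v x).im = (EE H v (y (2 * i))).im := by
  apply (EE_nice hH v (y 1 - 1) (y 1 - 1)).int hy h1 h2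
  have h0 : y 1 ≤ y (2 * i - 1) := by
    rcases h1.eq_or_lt with h3 | h3
    · rw [← h3]
    · exact (hy 1 (2 * i - 1) (by omega) (by omega) (by omega)).le
  intro x hx
  have : x ≠ y 1 - 1 := by
    have := hx.1
    intro h
    linarith
  exact ⟨this, this⟩

lemma EE_bound (hH : ∀ k, ∀ t s : ℝ,
      Nice N y t s (H k) (fun w => I * w ^ (k : ℕ) / SS (2 * N) y w)) (hN : 2 ≤ N)
    (hy : ∀ i j : ℕ, 1 ≤ i → i < j → j ≤ 2 * N → y i < y j)
    (ht : y 1 < t) (hts : t < s) (hs : s < y 2)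
    (v : (Fin (N - 1) → ℝ) × ℝ) {B : ℝ}
    (hB : ∀ i, 1 ≤ i → i ≤ N → (EE H v (y (2 * i))).im ≤ B) :
    ∀ z ∈ UHP, (EE H v z).im ≤ B := by
  have hn := EE_nice hH v t s
  obtain ⟨M, hM⟩ := hn.bdd
  refine maxp (v := fun z => (EE H v z).im) hN hy ht hts
    (fun z hz => (hn.der z hz).differentiableAt.differentiableWithinAt) (fun z _ => rfl)
    (Complex.continuous_im.comp_continuousOn hn.cont) (fun z hz => (le_abs_self _).trans (hM z hz))
    ?_ (fun k p hk he => hn.loc hN hy ht hts hs hk he)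
  intro i h1 h2 x hx _ _
  show (EE H v x).im ≤ B
  rw [EE_int hH hy v h1 h2 x hx]
  exact hB i h1 h2

lemma EE_zero_fst (v : (Fin (N - 1) → ℝ) × ℝ) (h : v.1 = 0) (z : ℂ) : (EE H v z).im = v.2 := by
  simp [EE, h]

lemma EE_inj1 (hH : ∀ k, ∀ t s : ℝ,
      Nice N y t s (H k) (fun w => I * w ^ (k : ℕ) / SS (2 * N) y w)) (hN : 2 ≤ N)
    (hy : ∀ i j : ℕ, 1 ≤ i → i < j → j ≤ 2 * N → y i < y j)
    (ht : y 1 < t) (hts : t < s) (hs : s < y 2)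
    (v : (Fin (N - 1) → ℝ) × ℝ)
    (hB : ∀ i, 1 ≤ i → i ≤ N → (EE H v (y (2 * i))).im = 0) : v = 0 := by
  have h1 := EE_bound hH hN hy ht hts hs v (fun i a b => (hB i a b).le)
  have h2 := EE_bound hH hN hy ht hts hs ((-1 : ℝ) • v) (B := 0) (fun i a b => by
    rw [EE_smul, Complex.im_ofReal_mul, hB i a b, mul_zero])
  have h3 : ∀ z ∈ UHP, (EE H v z).im = 0 := by
    intro z hz
    have a := h1 z hz
    have b := h2 z hz
    rw [EE_smul, Complex.im_ofReal_mul] at b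
    linarith
  have h4 : v.1 = 0 := by
    apply coef_zero (y := y) v (T := UHP)
    · apply infinite_of_mem_nhds I (isOpen_UHP.mem_nhds _)
      simp [mem_UHP]
    · intro w hw
      exact deriv_zero_of_im h3 hw ((EE_nice hH v t s).der w hw)
  have h5 := h3 I (by simp [mem_UHP])
  rw [EE_zero_fst v h4] at h5
  exact Prod.ext h4 h5

lemma EE_le2 (hH : ∀ k, ∀ t s : ℝ,
      Nice N y t s (H k) (fun w => I * w ^ (k : ℕ) / SS (2 * N) y w)) (hN : 2 ≤ N)
    (hy : ∀ i j : ℕ, 1 ≤ i → i < j → j ≤ 2 * N → y i < y j)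
    (ht : y 1 < t) (hts : t < s) (hs : s < y 2)
    (v : (Fin (N - 1) → ℝ) × ℝ) (h1 : (EE H v (y 2)).im = 0) (h2 : (EE H v (y (2 * N))).im = 0)
    (h3 : ∀ i, 2 ≤ i → i ≤ N - 1 → (EE H v (y (2 * i))).re = (EE H v (y (2 * i - 1))).re) :
    ∀ i, 1 ≤ i → i ≤ N → (EE H v (y (2 * i))).im ≤ 0 := by
  obtain ⟨m, hm, hmax⟩ := Finset.exists_max_image (Finset.Icc 1 N)
    (fun i => (EE H v (y (2 * i))).im) ⟨1, by simp; omega⟩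
  rw [Finset.mem_Icc] at hm
  suffices hb : (EE H v (y (2 * m))).im ≤ 0 from
    fun i a b => (hmax i (Finset.mem_Icc.2 ⟨a, b⟩)).trans hb
  by_contra hpos
  push Not at hpos
  have hm1 : m ≠ 1 := by
    rintro rfl
    simp [h1] at hpos
  have hmN : m ≠ N := by
    rintro rfl
    simp [h2] at hpos
  have hB := EE_bound hH hN hy ht hts hs v (fun i a b => hmax i (Finset.mem_Icc.2 ⟨a, b⟩))
  have hn := EE_nice hH v (y 1) (y 1)
  set φ := (fun w => (I / SS (2 * N) y w) * ∑ k, (v.1 k : ℂ) * w ^ (k : ℕ)) with hφ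
  have hlt := hy (2 * m - 1) (2 * m) (by omega) (by omega) (by omega)
  have hlt1 := hy 1 (2 * m - 1) (by omega) (by omega) (by omega)
  have hne : ∀ x ∈ Icc (y (2 * m - 1)) (y (2 * m)), x ≠ y 1 :=
    fun x hx => (hlt1.trans_le hx.1).ne'
  have hJ : ∀ x ∈ Ioo (y (2 * m - 1)) (y (2 * m)), InJ (2 * N) y (2 * m - 1) x := by
    intro x hx
    apply InJ_of_Ioo hy (by omega) (by omega)
    rwa [Nat.sub_add_cancel (by omega)]
  have hder : ∀ x ∈ Ioo (y (2 * m - 1)) (y (2 * m)),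
      HasDerivAt (fun u : ℝ => (EE H v u).re) (φ x).re x ∧ (φ x).re ≤ 0 ∧ (φ x).im = 0 := by
    intro x hx
    have h4 := hne x (Ioo_subset_Icc_self hx)
    have h5 := hn.bder _ x (hJ x hx) h4 h4
    refine ⟨hasDerivAt_re (real_deriv_of_within h5), ?_, ?_⟩
    · apply re_nonpos_of_im_le h5
      intro z hz
      rw [EE_int hH hy v hm.1 hm.2 x (Ioo_subset_Icc_self hx)]
      exact hB z hz
    · exact hn.od _ x (hJ x hx) h4 h4 ⟨m - 1, by omega⟩
  have hanti : AntitoneOn (fun u : ℝ => (EE H v u).re) (Icc (y (2 * m - 1)) (y (2 * m))) := by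
    apply antitoneOn_of_deriv_nonpos (convex_Icc _ _)
    · exact Complex.continuous_re.comp_continuousOn
        (hn.contReal (fun x hx => ⟨hne x hx, hne x hx⟩))
    · rw [interior_Icc]
      intro x hx
      exact (hder x hx).1.differentiableAt.differentiableWithinAt
    · rw [interior_Icc]
      intro x hx
      rw [(hder x hx).1.deriv]
      exact (hder x hx).2.1
  have hend := h3 m (by omega) (by omega)
  have hconst : ∀ x ∈ Icc (y (2 * m - 1)) (y (2 * m)), (EE H v x).re = (EE H v (y (2 * m))).re := by
    intro x hx
    have a := hanti ⟨le_rfl, hlt.le⟩ hx hx.1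
    have b := hanti hx ⟨hlt.le, le_rfl⟩ hx.2
    simp only at a b
    linarith
  have hz : ∀ x ∈ Ioo (y (2 * m - 1)) (y (2 * m)), φ x = 0 := by
    intro x hx
    have h4 : (fun u : ℝ => (EE H v u).re) =ᶠ[𝓝 x] fun _ => (EE H v (y (2 * m))).re := by
      filter_upwards [Ioo_mem_nhds hx.1 hx.2] with u hu
      exact hconst u (Ioo_subset_Icc_self hu)
    have h5 := (hder x hx).1.unique ((hasDerivAt_const x _).congr_of_eventuallyEq h4)
    exact Complex.ext h5 (hder x hx).2.2
  have h4 : v.1 = 0 := by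
    apply coef_zero (y := y) v (T := (fun x : ℝ => (x : ℂ)) '' Ioo (y (2 * m - 1)) (y (2 * m)))
    · exact (Ioo_infinite hlt).image (Complex.ofReal_injective.injOn)
    · rintro _ ⟨x, hx, rfl⟩
      exact hz x hx
  rw [EE_zero_fst v h4] at h1 hpos
  linarith

lemma EE_inj2 (hH : ∀ k, ∀ t s : ℝ,
      Nice N y t s (H k) (fun w => I * w ^ (k : ℕ) / SS (2 * N) y w)) (hN : 2 ≤ N)
    (hy : ∀ i j : ℕ, 1 ≤ i → i < j → j ≤ 2 * N → y i < y j)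
    (ht : y 1 < t) (hts : t < s) (hs : s < y 2)
    (v : (Fin (N - 1) → ℝ) × ℝ) (h1 : (EE H v (y 2)).im = 0) (h2 : (EE H v (y (2 * N))).im = 0)
    (h3 : ∀ i, 2 ≤ i → i ≤ N - 1 → (EE H v (y (2 * i))).re = (EE H v (y (2 * i - 1))).re) :
    v = 0 := by
  have a := EE_le2 hH hN hy ht hts hs v h1 h2 h3
  have b := EE_le2 hH hN hy ht hts hs ((-1 : ℝ) • v)
    (by rw [EE_smul, Complex.im_ofReal_mul, h1, mul_zero])
    (by rw [EE_smul, Complex.im_ofReal_mul, h2, mul_zero])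
    (fun i h4 h5 => by
      rw [EE_smul, EE_smul, Complex.re_ofReal_mul, Complex.re_ofReal_mul, h3 i h4 h5])
  apply EE_inj1 hH hN hy ht hts hs v
  intro i h4 h5
  have c := a i h4 h5
  have d := b i h4 h5
  rw [EE_smul, Complex.im_ofReal_mul] at d
  linarith

lemma EE_surj1 (hH : ∀ k, ∀ t s : ℝ,
      Nice N y t s (H k) (fun w => I * w ^ (k : ℕ) / SS (2 * N) y w)) (hN : 2 ≤ N)
    (hy : ∀ i j : ℕ, 1 ≤ i → i < j → j ≤ 2 * N → y i < y j)
    (ht : y 1 < t) (hts : t < s) (hs : s < y 2) (b : ℕ → ℝ) :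
    ∃ v : (Fin (N - 1) → ℝ) × ℝ, ∀ i, 1 ≤ i → i ≤ N → (EE H v (y (2 * i))).im = b i := by
  set L : ((Fin (N - 1) → ℝ) × ℝ) →ₗ[ℝ] (Fin N → ℝ) :=
    { toFun := fun v i => (EE H v (y (2 * ((i : ℕ) + 1)))).im
      map_add' := fun v w => by funext i; simp only [EE_add, Complex.add_im, Pi.add_apply]
      map_smul' := fun c v => by
        funext i
        simp only [EE_smul, Complex.im_ofReal_mul, Pi.smul_apply, smul_eq_mul, RingHom.id_apply] }
    with hL
  have hfr : Module.finrank ℝ ((Fin (N - 1) → ℝ) × ℝ) = Module.finrank ℝ (Fin N → ℝ) := by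
    rw [Module.finrank_prod, Module.finrank_fin_fun, Module.finrank_fin_fun, Module.finrank_self]
    omega
  have hinj : Function.Injective L := by
    rw [injective_iff_map_eq_zero]
    intro v hv
    apply EE_inj1 hH hN hy ht hts hs v
    intro i h1 h2
    have := congrFun hv ⟨i - 1, by omega⟩
    simp only [hL, LinearMap.coe_mk, AddHom.coe_mk, Pi.zero_apply, Nat.sub_add_cancel h1] at this
    exact this
  obtain ⟨v, hv⟩ := (LinearMap.injective_iff_surjective_of_finrank_eq_finrank hfr).1 hinj
    (fun i => b ((i : ℕ) + 1))
  refine ⟨v, fun i h1 h2 => ?_⟩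
  have := congrFun hv ⟨i - 1, by omega⟩
  simp only [hL, LinearMap.coe_mk, AddHom.coe_mk, Nat.sub_add_cancel h1] at this
  exact this

lemma EE_surj2 (hH : ∀ k, ∀ t s : ℝ,
      Nice N y t s (H k) (fun w => I * w ^ (k : ℕ) / SS (2 * N) y w)) (hN : 2 ≤ N)
    (hy : ∀ i j : ℕ, 1 ≤ i → i < j → j ≤ 2 * N → y i < y j)
    (ht : y 1 < t) (hts : t < s) (hs : s < y 2) (A B : ℝ) (c : ℕ → ℝ) :
    ∃ v : (Fin (N - 1) → ℝ) × ℝ, (EE H v (y 2)).im = A ∧ (EE H v (y (2 * N))).im = B ∧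
      ∀ i, 2 ≤ i → i ≤ N - 1 → (EE H v (y (2 * i))).re - (EE H v (y (2 * i - 1))).re = c i := by
  set L : ((Fin (N - 1) → ℝ) × ℝ) →ₗ[ℝ] (Fin N → ℝ) :=
    { toFun := fun v i => if (i : ℕ) + 1 = 1 ∨ (i : ℕ) + 1 = N then
          (EE H v (y (2 * ((i : ℕ) + 1)))).im else
          (EE H v (y (2 * ((i : ℕ) + 1)))).re - (EE H v (y (2 * ((i : ℕ) + 1) - 1))).re
      map_add' := fun v w => by
        funext i
        simp only [EE_add, Complex.add_im, Complex.add_re, Pi.add_apply]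
        split_ifs
        · rfl
        · ring
      map_smul' := fun c v => by
        funext i
        simp only [EE_smul, Complex.im_ofReal_mul, Complex.re_ofReal_mul, Pi.smul_apply,
          smul_eq_mul, RingHom.id_apply]
        split_ifs
        · rfl
        · ring }
    with hL
  have hLap : ∀ v i (h1 : 1 ≤ i) (h2 : i ≤ N), L v ⟨i - 1, by omega⟩ = if i = 1 ∨ i = N then
          (EE H v (y (2 * i))).im else (EE H v (y (2 * i))).re - (EE H v (y (2 * i - 1))).re := by
    intro v i h1 h2
    simp only [hL, LinearMap.coe_mk, AddHom.coe_mk, Nat.sub_add_cancel h1]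
  have hfr : Module.finrank ℝ ((Fin (N - 1) → ℝ) × ℝ) = Module.finrank ℝ (Fin N → ℝ) := by
    rw [Module.finrank_prod, Module.finrank_fin_fun, Module.finrank_fin_fun, Module.finrank_self]
    omega
  have hinj : Function.Injective L := by
    rw [injective_iff_map_eq_zero]
    intro v hv
    apply EE_inj2 hH hN hy ht hts hs v
    · have := hLap v 1 le_rfl (by omega)
      rw [hv, if_pos (Or.inl rfl)] at this
      exact this.symm
    · have := hLap v N (by omega) (by omega)
      rw [hv, if_pos (Or.inr rfl)] at this
      exact this.symm
    · intro i h1 h2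
      have := hLap v i (by omega) (by omega)
      rw [hv, if_neg (by omega)] at this
      simp only [Pi.zero_apply] at this
      linarith
  obtain ⟨v, hv⟩ := (LinearMap.injective_iff_surjective_of_finrank_eq_finrank hfr).1 hinj
    (fun i => if (i : ℕ) = 0 then A else if (i : ℕ) = N - 1 then B else c ((i : ℕ) + 1))
  refine ⟨v, ?_, ?_, ?_⟩
  · have := hLap v 1 le_rfl (by omega)
    rw [hv, if_pos (Or.inl rfl)] at this
    simpa using this.symm
  · have := hLap v N (by omega) (by omega)
    rw [hv, if_pos (Or.inr rfl)] at this
    simp only [if_neg (show ¬ N - 1 = 0 by omega), if_true] at this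
    exact this.symm
  · intro i h1 h2
    have := hLap v i (by omega) (by omega)
    rw [hv, if_neg (by omega)] at this
    simp only [if_neg (show ¬ i - 1 = 0 by omega), if_neg (show ¬ i - 1 = N - 1 by omega),
      Nat.sub_add_cancel (show 1 ≤ i by omega)] at this
    exact this.symm

end lin

/-- The regularised kernel at `a`. -/
def Qa (n : ℕ) (y : ℕ → ℝ) (a : ℝ) (w : ℂ) : ℂ := (SS n y a / SS n y w - 1) / (w - a)

def bb (w : ℂ) : ℝ := 1 / (√w.im * (1 + ‖w‖))

lemma bb_nonneg (w : ℂ) : 0 ≤ bb w := by unfold bb; positivity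

lemma sq_bb {w : ℂ} (hw : w ∈ UHP) : 1 ≤ (1 + ‖w‖) ^ 2 * bb w := by
  have h0 : 0 < √w.im := Real.sqrt_pos.2 hw
  have h1 : √w.im ≤ 1 + ‖w‖ := by
    have h2 : w.im ≤ ‖w‖ := (le_abs_self _).trans (Complex.abs_im_le_norm w)
    apply Real.sqrt_le_iff.2
    constructor
    · positivity
    · nlinarith [norm_nonneg w]
  unfold bb
  rw [mul_one_div, le_div_iff₀ (by positivity)]
  nlinarith [norm_nonneg w]

lemma Qa_near {n k : ℕ} {y : ℕ → ℝ} {a : ℝ} (h : InJ n y k a) :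
    ∃ δ > 0, ∃ K : ℝ, 0 ≤ K ∧ ∀ w : ℂ, w ∈ UHP → ‖w - a‖ < δ → ‖Qa n y a w‖ ≤ K := by
  have h1 : HasDerivAt (fun w => SS n y a / SS n y w)
      (deriv (fun w => SS n y a / SS n y w) a) a := by
    apply DifferentiableAt.hasDerivAt
    exact (differentiableAt_const _).div (phi_cont h) (SS_ne _ _ _)
  have h2 := h1.tendsto_slope.norm
  have h3 := h2.eventually_lt_const
    (show ‖deriv (fun w => SS n y a / SS n y w) a‖ < ‖deriv (fun w => SS n y a / SS n y w) a‖ + 1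
      by linarith)
  rw [eventually_nhdsWithin_iff, Metric.eventually_nhds_iff] at h3
  obtain ⟨δ, hδ, h4⟩ := h3
  refine ⟨δ, hδ, ‖deriv (fun w => SS n y a / SS n y w) a‖ + 1, by positivity, fun w hw hwa => ?_⟩
  have h5 := (h4 (y := w) (by rwa [dist_eq_norm]) (ne_real_of_UHP hw a)).le
  rw [slope_def_field, div_self (SS_ne _ _ _)] at h5
  exact h5

lemma inv_far {a δ : ℝ} (hδ : 0 < δ) :
    ∃ L : ℝ, 0 ≤ L ∧ ∀ w : ℂ, δ ≤ ‖w - a‖ → ‖(w - a)⁻¹‖ ≤ L / (1 + ‖w‖) := by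
  refine ⟨(1 + |a|) / δ + 1, by positivity, fun w hw => ?_⟩
  have h1 : ‖w‖ ≤ ‖w - a‖ + |a| := by
    have := norm_add_le (w - a) (a : ℂ)
    simpa using this
  have h2 : 0 < ‖w - a‖ := lt_of_lt_of_le hδ hw
  rw [norm_inv, le_div_iff₀ (by positivity), inv_mul_le_iff₀ h2]
  have h3 : (1 + |a|) ≤ ‖w - a‖ * ((1 + |a|) / δ) := by
    have : (1 + |a|) = δ * ((1 + |a|) / δ) := by field_simp
    calc (1 + |a|) = δ * ((1 + |a|) / δ) := this
      _ ≤ _ := by gcongr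
  linarith

section rho
variable {N : ℕ} {y : ℕ → ℝ} {t s : ℝ}

lemma rho_bound (hN : 2 ≤ N) (hy : ∀ i j : ℕ, 1 ≤ i → i < j → j ≤ 2 * N → y i < y j)
    (ht : y 1 < t) (hts : t < s) (hs : s < y 2) :
    ∃ C : ℝ, 0 ≤ C ∧ ∀ w ∈ UHP, ‖Qa (2 * N) y s w - Qa (2 * N) y t w‖ ≤ C * bb w := by
  obtain ⟨C, hC, hb⟩ := pow_div_SS_bound' hy (k := 0) (by omega)
  obtain ⟨δ₁, hδ₁, K₁, hK₁, hn₁⟩ := Qa_near (InJ_one hN hy (ht.trans hts) hs)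
  obtain ⟨δ₂, hδ₂, K₂, hK₂, hn₂⟩ := Qa_near (InJ_one hN hy ht (hts.trans hs))
  set δ := min (min δ₁ δ₂) ((s - t) / 2) with hδdef
  have hδ : 0 < δ := lt_min (lt_min hδ₁ hδ₂) (by linarith)
  have hle1 : δ ≤ δ₁ := (min_le_left _ _).trans (min_le_left _ _)
  have hle2 : δ ≤ δ₂ := (min_le_left _ _).trans (min_le_right _ _)
  have hle3 : δ ≤ (s - t) / 2 := min_le_right _ _
  obtain ⟨L₁, hL₁, hi₁⟩ := inv_far (a := s) hδ
  obtain ⟨L₂, hL₂, hi₂⟩ := inv_far (a := t) hδ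
  have hfar : ∀ a : ℝ, ∀ w ∈ UHP, δ ≤ ‖w - a‖ →
      ‖SS (2 * N) y a / SS (2 * N) y w * (w - a)⁻¹‖ ≤ (‖SS (2 * N) y a‖ * C / δ) * bb w := by
    intro a w hw hwa
    have h1 : ‖(w - a)⁻¹‖ ≤ 1 / δ := by
      rw [norm_inv, ← one_div]; exact one_div_le_one_div_of_le hδ hwa
    have h2 := hb w hw
    rw [pow_zero] at h2
    have h3 : SS (2 * N) y a / SS (2 * N) y w = SS (2 * N) y a * (1 / SS (2 * N) y w) := by ring
    rw [h3, norm_mul, norm_mul]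
    calc ‖SS (2 * N) y a‖ * ‖1 / SS (2 * N) y w‖ * ‖(w - a)⁻¹‖
        ≤ ‖SS (2 * N) y a‖ * (C * bb w) * (1 / δ) := by
          have := bb_nonneg w
          gcongr
          exact h2
      _ = _ := by ring
  have hsplit : ∀ a : ℝ, ∀ w, Qa (2 * N) y a w =
      SS (2 * N) y a / SS (2 * N) y w * (w - a)⁻¹ - (w - a)⁻¹ := by
    intro a w
    unfold Qa
    ring
  -- one-sided bound far from `a`
  have hone : ∀ a L : ℝ, 0 ≤ L → (∀ w : ℂ, δ ≤ ‖w - a‖ → ‖(w - a)⁻¹‖ ≤ L / (1 + ‖w‖)) →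
      ∀ D : ℝ, ∀ w ∈ UHP, δ ≤ ‖w - a‖ → 1 + ‖w‖ ≤ D →
      ‖Qa (2 * N) y a w‖ ≤ (‖SS (2 * N) y a‖ * C / δ + L * D ^ 2) * bb w := by
    intro a L hL hi D w hw hwa hD
    have hb0 := bb_nonneg w
    rw [hsplit]
    refine (norm_sub_le _ _).trans ?_
    rw [add_mul]
    apply add_le_add (hfar a w hw hwa)
    refine (hi w hwa).trans ?_
    have h1 : L / (1 + ‖w‖) ≤ L := div_le_self hL (by linarith [norm_nonneg w])
    have h2 : (1 + ‖w‖) ^ 2 * bb w ≤ D ^ 2 * bb w := by gcongr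
    have h3 := sq_bb hw
    calc L / (1 + ‖w‖) ≤ L * 1 := by rw [mul_one]; exact h1
      _ ≤ L * (D ^ 2 * bb w) := by gcongr; exact h3.trans h2
      _ = _ := by ring
  have hnear : ∀ a : ℝ, ∀ w : ℂ, ‖w - a‖ < δ → 1 + ‖w‖ ≤ 1 + |a| + δ := by
    intro a w h
    have := norm_add_le (w - a) (a : ℂ)
    simp at this
    linarith
  have hst : ∀ w : ℂ, s - t ≤ ‖w - s‖ + ‖w - t‖ := by
    intro w
    have h1 : ‖((s - t : ℝ) : ℂ)‖ = s - t := by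
      rw [Complex.norm_real, Real.norm_of_nonneg (by linarith)]
    have h2 : ((s - t : ℝ) : ℂ) = (w - t) - (w - s) := by push_cast; ring
    rw [← h1, h2]
    have := norm_sub_le (w - (t : ℂ)) (w - s)
    linarith
  set D₁ := 1 + |s| + δ
  set D₂ := 1 + |t| + δ
  set P₁ := ‖SS (2 * N) y s‖ * C / δ
  set P₂ := ‖SS (2 * N) y t‖ * C / δ
  have hP₁ : 0 ≤ P₁ := by positivity
  have hP₂ : 0 ≤ P₂ := by positivity
  have hcase : ∀ (K D : ℝ), 0 ≤ K → ∀ w ∈ UHP, 1 + ‖w‖ ≤ D → K ≤ K * D ^ 2 * bb w := by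
    intro K D hK w hw hD
    have hb0 := bb_nonneg w
    have h2 : (1 + ‖w‖) ^ 2 * bb w ≤ D ^ 2 * bb w := by gcongr
    have h3 := sq_bb hw
    calc K = K * 1 := by ring
      _ ≤ K * (D ^ 2 * bb w) := by gcongr; exact h3.trans h2
      _ = _ := by ring
  refine ⟨(K₁ * D₁ ^ 2 + (P₂ + L₂ * D₁ ^ 2)) + (K₂ * D₂ ^ 2 + (P₁ + L₁ * D₂ ^ 2)) +
    (P₁ + P₂ + (s - t) * (L₁ * L₂)), ?_, ?_⟩
  · have : 0 ≤ s - t := by linarith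
    positivity
  intro w hw
  have hb0 := bb_nonneg w
  have hst0 : 0 ≤ s - t := by linarith
  have q1 : 0 ≤ (K₁ * D₁ ^ 2 + (P₂ + L₂ * D₁ ^ 2)) * bb w := by positivity
  have q2 : 0 ≤ (K₂ * D₂ ^ 2 + (P₁ + L₁ * D₂ ^ 2)) * bb w := by positivity
  have q3 : 0 ≤ (P₁ + P₂ + (s - t) * (L₁ * L₂)) * bb w := by positivity
  rw [add_mul, add_mul]
  rcases lt_or_ge ‖w - s‖ δ with h1 | h1
  · have h2 : δ ≤ ‖w - t‖ := by linarith [hst w]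
    have a1 := (hn₁ w hw (h1.trans_le hle1)).trans (hcase K₁ D₁ hK₁ w hw (hnear s w h1))
    have a2 := hone t L₂ hL₂ hi₂ D₁ w hw h2 (hnear s w h1)
    have a3 := norm_sub_le (Qa (2 * N) y s w) (Qa (2 * N) y t w)
    rw [add_mul] at q1 ⊢
    linarith
  rcases lt_or_ge ‖w - t‖ δ with h2 | h2
  · have a1 := (hn₂ w hw (h2.trans_le hle2)).trans (hcase K₂ D₂ hK₂ w hw (hnear t w h2))
    have a2 := hone s L₁ hL₁ hi₁ D₂ w hw h1 (hnear t w h2)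
    have a3 := norm_sub_le (Qa (2 * N) y s w) (Qa (2 * N) y t w)
    rw [add_mul (K₂ * D₂ ^ 2)] at q2 ⊢
    linarith
  · have e : Qa (2 * N) y s w - Qa (2 * N) y t w =
        SS (2 * N) y s / SS (2 * N) y w * (w - s)⁻¹ - SS (2 * N) y t / SS (2 * N) y w * (w - t)⁻¹
        - ((s - t : ℝ) : ℂ) * ((w - s)⁻¹ * (w - t)⁻¹) := by
      rw [hsplit, hsplit]
      have n1 : w - s ≠ 0 := sub_ne_zero.2 (ne_real_of_UHP hw s)
      have n2 : w - t ≠ 0 := sub_ne_zero.2 (ne_real_of_UHP hw t)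
      have e1 : (w - s)⁻¹ - (w - t)⁻¹ = ((s - t : ℝ) : ℂ) * ((w - s)⁻¹ * (w - t)⁻¹) := by
        push_cast
        field_simp
        ring
      rw [← e1]
      ring
    have a1 := hfar s w hw h1
    have a2 := hfar t w hw h2
    have a3 : ‖((s - t : ℝ) : ℂ) * ((w - s)⁻¹ * (w - t)⁻¹)‖ ≤ (s - t) * (L₁ * L₂) * bb w := by
      rw [norm_mul, norm_mul, Complex.norm_real, Real.norm_of_nonneg hst0, mul_assoc]
      apply mul_le_mul_of_nonneg_left _ hst0
      calc ‖(w - s)⁻¹‖ * ‖(w - t)⁻¹‖ ≤ (L₁ / (1 + ‖w‖)) * (L₂ / (1 + ‖w‖)) :=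
            mul_le_mul (hi₁ w h1) (hi₂ w h2) (norm_nonneg _) (by positivity)
        _ = L₁ * L₂ * (1 / (1 + ‖w‖) ^ 2) := by field_simp
        _ ≤ L₁ * L₂ * bb w := by
          apply mul_le_mul_of_nonneg_left _ (by positivity)
          rw [div_le_iff₀ (by positivity), mul_comm]
          exact sq_bb hw
    have a4 : ‖Qa (2 * N) y s w - Qa (2 * N) y t w‖ ≤ P₁ * bb w + P₂ * bb w
        + (s - t) * (L₁ * L₂) * bb w := by
      rw [e]
      exact (norm_sub_le _ _).trans (add_le_add ((norm_sub_le _ _).trans (add_le_add a1 a2)) a3)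
    have a5 : (P₁ + P₂ + (s - t) * (L₁ * L₂)) * bb w = P₁ * bb w + P₂ * bb w
        + (s - t) * (L₁ * L₂) * bb w := by ring
    linarith

lemma log_ratio (t s : ℝ) (l : Filter ℝ) (hl : Tendsto (fun x : ℝ => (x - t)⁻¹) l (𝓝 0))
    (h1 : ∀ᶠ x in l, x ≠ t) (h2 : ∀ᶠ x in l, x ≠ s) :
    Tendsto (fun x : ℝ => (Lg ((x : ℂ) - s) - Lg ((x : ℂ) - t)).re) l (𝓝 0) := by
  have h3 : Tendsto (fun x : ℝ => 1 + (t - s) * (x - t)⁻¹) l (𝓝 1) := by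
    simpa using (hl.const_mul (t - s)).const_add 1
  have h4 := (Real.continuousAt_log one_ne_zero).tendsto.comp h3
  rw [Real.log_one] at h4
  refine h4.congr' ?_
  filter_upwards [h1, h2] with x a b
  have a' : x - t ≠ 0 := sub_ne_zero.2 a
  have b' : x - s ≠ 0 := sub_ne_zero.2 b
  have e : 1 + (t - s) * (x - t)⁻¹ = (x - s) / (x - t) := by field_simp; ring
  simp only [Function.comp_apply]
  rw [e, Real.log_div b' a', Complex.sub_re, Lg_re, Lg_re, ← Complex.ofReal_sub, ← Complex.ofReal_sub,
    Complex.norm_real, Complex.norm_real, Real.norm_eq_abs, Real.norm_eq_abs, Real.log_abs,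
    Real.log_abs]

lemma Qa_real {a x : ℝ} {k : ℕ} (ha : InJ (2 * N) y 1 a) (hx : InJ (2 * N) y k x) :
    (Even k → (((x : ℂ) - a)⁻¹ + Qa (2 * N) y a x).re = 0) ∧
    (Odd k → (((x : ℂ) - a)⁻¹ + Qa (2 * N) y a x).im = 0) := by
  have e : ((x : ℂ) - a)⁻¹ + Qa (2 * N) y a x =
      (((x - a)⁻¹ : ℝ) : ℂ) * (SS (2 * N) y a / SS (2 * N) y x) := by
    unfold Qa
    push_cast
    ring
  have h1 := (SS_real ha).2 ((Nat.odd_sub ha.1).2 (iff_of_false (by simp) (by simp)))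
  have h2 : SS (2 * N) y a = I * ((SS (2 * N) y a).im : ℂ) := by
    apply Complex.ext <;> simp [h1]
  rw [e, Complex.re_ofReal_mul, Complex.im_ofReal_mul]
  constructor
  · intro he
    have h7 := (SS_real hx).1 ((Nat.even_sub hx.1).2 (by simp [he]))
    have h8 : SS (2 * N) y x = ((SS (2 * N) y x).re : ℂ) := by
      apply Complex.ext <;> simp [h7]
    rw [h8, h2, Complex.div_ofReal_re, Complex.re_mul_ofReal, Complex.I_re]
    simp
  · intro he
    have h7 := (SS_real hx).2 ((Nat.odd_sub hx.1).2
      (iff_of_false (by simp) (Nat.not_even_iff_odd.2 he)))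
    have h8 : SS (2 * N) y x = I * ((SS (2 * N) y x).im : ℂ) := by
      apply Complex.ext <;> simp [h7]
    rw [h8, h2, mul_div_mul_left _ _ Complex.I_ne_zero, ← Complex.ofReal_div,
        Complex.ofReal_im, mul_zero]

end rho

lemma h0_exists {N : ℕ} {y : ℕ → ℝ} {t s : ℝ} (hN : 2 ≤ N)
    (hy : ∀ i j : ℕ, 1 ≤ i → i < j → j ≤ 2 * N → y i < y j)
    (ht : y 1 < t) (hts : t < s) (hs : s < y 2) :
    ∃ h χ : ℂ → ℂ, Nice N y t s h χ ∧ 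
      (∀ x ∈ Icc (y 1) (y 2), x < t ∨ s < x → (h x).im = (h (y 2)).im) ∧
      (∀ x ∈ Ioo t s, (h x).im = (h (y 2)).im + 1) := by
  have hJs := InJ_one hN hy (ht.trans hts) hs
  have hJt := InJ_one hN hy ht (hts.trans hs)
  have hπ := Real.pi_pos
  obtain ⟨C, hC, hb⟩ := rho_bound hN hy ht hts hs
  set n := 2 * N with hn
  set ρ : ℂ → ℂ := fun w => Qa n y s w - Qa n y t w with hρ
  have hQd : ∀ a : ℝ, ∀ w : ℂ, w ≠ a → DifferentiableAt ℂ (SS n y) w →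
      DifferentiableAt ℂ (Qa n y a) w := by
    intro a w hwa hd
    unfold Qa
    exact ((((differentiableAt_const _).div hd (SS_ne _ _ _)).sub (differentiableAt_const _)).div
      (differentiableAt_id.sub (differentiableAt_const _)) (sub_ne_zero.2 hwa))
  have hρd : DifferentiableOn ℂ ρ UHP := by
    intro w hw
    have hd := (SS_diffOn n y).differentiableAt (isOpen_UHP.mem_nhds hw)
    exact ((hQd s w (ne_real_of_UHP hw s) hd).sub
      (hQd t w (ne_real_of_UHP hw t) hd)).differentiableWithinAt
  obtain ⟨G, hG1, ⟨M, hG2⟩, hG3, hG4, hG5, hG6⟩ := primitive_exists hC hρd hb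
  have hG4' : ∀ k x, InJ n y k x → x ≠ t → x ≠ s → HasDerivWithinAt G (ρ x) (closure UHP) x := by
    intro k x hx h1 h2
    apply hG4
    apply ContinuousAt.continuousWithinAt
    have h1' : (x : ℂ) ≠ t := by exact_mod_cast h1
    have h2' : (x : ℂ) ≠ s := by exact_mod_cast h2
    exact ((hQd s x h2' (phi_cont hx)).sub (hQd t x h1' (phi_cont hx))).continuousAt
  set ℓ : ℂ → ℂ := fun z => Lg (z - s) - Lg (z - t) with hℓ
  have hℓd : ∀ z : ℂ, 0 ≤ z.im → z ≠ t → z ≠ s →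
      HasDerivAt ℓ ((z - s)⁻¹ - (z - t)⁻¹) z := by
    intro z hz h1 h2
    exact (Lg_sub_hasDerivAt hz h2).sub (Lg_sub_hasDerivAt hz h1)
  set h : ℂ → ℂ := fun z => ((Real.pi⁻¹ : ℝ) : ℂ) * (ℓ z + G z) with hh
  set χ : ℂ → ℂ := fun z => ((Real.pi⁻¹ : ℝ) : ℂ) * (((z - s)⁻¹ - (z - t)⁻¹) + ρ z) with hχ
  have hχ' : ∀ z, χ z = ((Real.pi⁻¹ : ℝ) : ℂ) * (((z - s)⁻¹ + Qa n y s z) - ((z - t)⁻¹ + Qa n y t z)) := by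
    intro z
    simp only [hχ, hρ]
    ring
  have hnice : Nice N y t s h χ := by
    refine ⟨?_, ?_, ?_, ?_, ?_, ?_, ?_, ?_⟩
    · apply ContinuousOn.const_mul
      apply ContinuousOn.add _ (hG1.mono sdiff_subset)
      intro z hz
      have h1 : z ≠ t := fun h => hz.2 (by simp [h])
      have h2 : z ≠ s := fun h => hz.2 (by simp [h])
      exact (hℓd z (mem_cUHP.1 hz.1) h1 h2).continuousAt.continuousWithinAt
    · refine ⟨Real.pi⁻¹ * (2 * Real.pi + 2 * Real.pi + M), fun z hz => ?_⟩
      rw [hh]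
      simp only [hℓ]
      rw [Complex.im_ofReal_mul, abs_mul, abs_of_pos (inv_pos.2 hπ)]
      apply mul_le_mul_of_nonneg_left _ (inv_pos.2 hπ).le
      rw [Complex.add_im, Complex.sub_im]
      have a1 := abs_le.1 (Lg_im_bound (z - s))
      have a2 := abs_le.1 (Lg_im_bound (z - t))
      have a3 := abs_le.1 ((Complex.abs_im_le_norm _).trans (hG2 z (subset_closure hz)))
      rw [abs_le]
      constructor <;> linarith [a1.1, a1.2, a2.1, a2.2, a3.1, a3.2]
    · intro z hz
      exact ((hℓd z (le_of_lt hz) (ne_real_of_UHP hz t) (ne_real_of_UHP hz s)).add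
        (hG3 z hz)).const_mul _
    · intro k x hx h1 h2
      have h1' : (x : ℂ) ≠ t := by exact_mod_cast h1
      have h2' : (x : ℂ) ≠ s := by exact_mod_cast h2
      exact ((hℓd x (by simp) h1' h2').hasDerivWithinAt.add (hG4' k x hx h1 h2)).const_mul _
    · intro k x hx h1 h2 he
      rw [hχ', Complex.re_ofReal_mul, Complex.sub_re, (Qa_real hJs hx).1 he, (Qa_real hJt hx).1 he]
      simp
    · intro k x hx h1 h2 he
      rw [hχ', Complex.im_ofReal_mul, Complex.sub_im, (Qa_real hJs hx).2 he, (Qa_real hJt hx).2 he]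
      simp
    · have h1 := log_ratio t s atTop (tendsto_inv_atTop_zero.comp
        (tendsto_atTop_add_const_right _ (-t) tendsto_id)) (eventually_ne_atTop t)
        (eventually_ne_atTop s)
      have h2 := (h1.add ((Complex.continuous_re.tendsto 0).comp hG5)).const_mul Real.pi⁻¹
      simpa [hh, hℓ] using h2
    · have h1 := log_ratio t s atBot (tendsto_inv_atBot_zero.comp
        (tendsto_atBot_add_const_right _ (-t) tendsto_id)) (eventually_ne_atBot t)
        (eventually_ne_atBot s)
      have h2 := (h1.add ((Complex.continuous_re.tendsto 0).comp hG6)).const_mul Real.pi⁻¹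
      simpa [hh, hℓ] using h2
  have hGim : ∀ a b : ℝ, y 1 ≤ a → b ≤ y 2 → (∀ x ∈ Ioo a b, x ≠ t ∧ x ≠ s) →
      ∀ x ∈ Icc a b, (G x).im = (G a).im := by
    intro a b ha hb' hne
    apply const_of_zero (f := fun u : ℝ => (G u).im)
    · apply Complex.continuous_im.comp_continuousOn
      apply hG1.comp (by fun_prop)
      intro x _
      exact real_mem_cUHP x
    · intro x hx
      have hJx := InJ_one hN hy (ha.trans_lt hx.1) (hx.2.trans_le hb')
      have h1 := hne x hx
      have h2 := hasDerivAt_im (real_deriv_of_within (hG4' 1 x hJx h1.1 h1.2))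
      have h3 : (ρ x).im = 0 := by
        have a1 := (Qa_real hJs hJx).2 (by decide)
        have a2 := (Qa_real hJt hJx).2 (by decide)
        have b1 : (((x : ℂ) - s)⁻¹).im = 0 := by
          rw [← Complex.ofReal_sub, ← Complex.ofReal_inv, Complex.ofReal_im]
        have b2 : (((x : ℂ) - t)⁻¹).im = 0 := by
          rw [← Complex.ofReal_sub, ← Complex.ofReal_inv, Complex.ofReal_im]
        rw [Complex.add_im, b1, zero_add] at a1
        rw [Complex.add_im, b2, zero_add] at a2
        rw [← hn] at a1 a2
        show (Qa n y s x - Qa n y t x).im = 0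
        rw [Complex.sub_im, a1, a2, sub_zero]
      rwa [h3] at h2
  have g1 := hGim (y 1) t le_rfl (by linarith) (fun x hx => ⟨hx.2.ne, (hx.2.trans hts).ne⟩)
  have g2 := hGim t s (by linarith) (by linarith) (fun x hx => ⟨hx.1.ne', hx.2.ne⟩)
  have g3 := hGim s (y 2) (by linarith) (by linarith) (fun x hx => ⟨(hts.trans hx.1).ne', hx.1.ne'⟩)
  have g1t := g1 t ⟨ht.le, le_rfl⟩
  have g2s := g2 s ⟨hts.le, le_rfl⟩
  have g3y := g3 (y 2) ⟨hs.le, le_rfl⟩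
  have him : ∀ x : ℝ, (h x).im = Real.pi⁻¹ * ((Lg ((x - s : ℝ) : ℂ)).im - (Lg ((x - t : ℝ) : ℂ)).im + (G x).im) := by
    intro x
    simp only [hh, hℓ]
    rw [Complex.im_ofReal_mul, Complex.add_im, Complex.sub_im]
    push_cast
    rfl
  refine ⟨h, χ, hnice, ?_, ?_⟩
  · intro x hx hx2
    rw [him, him, Lg_im_pos (show 0 < y 2 - s by linarith), Lg_im_pos (show 0 < y 2 - t by linarith)]
    rcases hx2 with h1 | h1
    · rw [Lg_im_neg (show x - s < 0 by linarith), Lg_im_neg (show x - t < 0 by linarith),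
        g1 x ⟨hx.1, h1.le⟩, g3y, g2s, g1t]
      ring
    · rw [Lg_im_pos (show 0 < x - s by linarith), Lg_im_pos (show 0 < x - t by linarith),
        g3 x ⟨h1.le, hx.2⟩, g3y]
  · intro x hx
    have h1 := hx.1
    have h2 := hx.2
    rw [him, him, Lg_im_pos (show 0 < y 2 - s by linarith), Lg_im_pos (show 0 < y 2 - t by linarith),
      Lg_im_neg (show x - s < 0 by linarith), Lg_im_pos (show 0 < x - t by linarith),
        g2 x ⟨h1.le, h2.le⟩, g3y, g2s]
    field_simp
    ring

lemma bd_val {t s a b c x : ℝ} {v : ℂ → ℝ}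
    (hv : ContinuousOn v (closure UHP \ {(t : ℂ), (s : ℂ)})) (hab : a < b) (hx : x ∈ Icc a b)
    (h1 : x ≠ t) (h2 : x ≠ s) (hc : ∀ u ∈ Ioo a b, u ≠ t → u ≠ s → v (u : ℂ) = c) :
    v (x : ℂ) = c := by
  have hne : (𝓝[Ioo a b] x).NeBot := by
    rw [← mem_closure_iff_nhdsWithin_neBot, closure_Ioo hab.ne]
    exact hx
  have e1 : ∀ᶠ u in 𝓝[Ioo a b] x, u ∈ Ioo a b ∧ u ≠ t ∧ u ≠ s := by
    filter_upwards [self_mem_nhdsWithin, mem_nhdsWithin_of_mem_nhds (isOpen_ne.mem_nhds h1),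
      mem_nhdsWithin_of_mem_nhds (isOpen_ne.mem_nhds h2)] with u a1 a2 a3
    exact ⟨a1, a2, a3⟩
  have e2 : Tendsto (fun u : ℝ => (u : ℂ)) (𝓝[Ioo a b] x)
      (𝓝[closure UHP \ {(t : ℂ), (s : ℂ)}] (x : ℂ)) := by
    refine tendsto_nhdsWithin_iff.2 ⟨?_, ?_⟩
    · exact (Complex.continuous_ofReal.tendsto x).mono_left nhdsWithin_le_nhds
    · filter_upwards [e1] with u hu
      exact real_mem_diff hu.2.1 hu.2.2
  have e3 : Tendsto (fun u : ℝ => v (u : ℂ)) (𝓝[Ioo a b] x) (𝓝 (v (x : ℂ))) :=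
    (hv x (real_mem_diff h1 h2)).tendsto.comp e2
  have e4 : Tendsto (fun u : ℝ => v (u : ℂ)) (𝓝[Ioo a b] x) (𝓝 c) := by
    refine tendsto_const_nhds.congr' ?_
    filter_upwards [e1] with u hu
    exact (hc u hu.1 hu.2.1 hu.2.2).symm
  exact tendsto_nhds_unique e3 e4

lemma bd_lim {t s c x : ℝ} {v : ℂ → ℝ} {f : ℂ → ℂ}
    (hv : ContinuousOn v (closure UHP \ {(t : ℂ), (s : ℂ)})) (hf : ∀ z ∈ UHP, v z = (f z).im)
    (h1 : x ≠ t) (h2 : x ≠ s)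
    (hc : Tendsto (fun z => (f z).im) (𝓝[UHP] (x : ℂ)) (𝓝 c)) : v (x : ℂ) = c := by
  have e3 : Tendsto v (𝓝[UHP] (x : ℂ)) (𝓝 (v (x : ℂ))) :=
    (hv x (real_mem_diff h1 h2)).mono (UHP_subset_diff t s)
  have e4 : Tendsto v (𝓝[UHP] (x : ℂ)) (𝓝 c) := by
    refine hc.congr' ?_
    filter_upwards [self_mem_nhdsWithin] with u hu
    exact (hf u hu).symm
  exact tendsto_nhds_unique e3 e4

/-- the data satisfied by the difference of two solutions -/
lemma diff_zero {N : ℕ} (hN : 2 ≤ N) {y : ℕ → ℝ}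
    (hy : ∀ i j : ℕ, 1 ≤ i → i < j → j ≤ 2 * N → y i < y j)
    {t s : ℝ} (ht : y 1 < t) (hts : t < s) (hs : s < y 2) {f : ℂ → ℂ} {w : ℂ → ℝ} {C c : ℝ}
    (hd : DifferentiableOn ℂ f UHP)
    (h1 : ∀ p : ℝ, (p < y 1 ∨ y (2 * N) < p) →
      Tendsto (fun z => (f z).re) (𝓝[UHP] (p : ℂ)) (𝓝 0))
    (h2 : ∀ i : ℕ, 1 ≤ i → i ≤ N - 1 → ∀ p ∈ Set.Ioo (y (2 * i)) (y (2 * i + 1)),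
      Tendsto (fun z => (f z).re) (𝓝[UHP] (p : ℂ)) (𝓝 c))
    (h3 : ∀ i : ℕ, 2 ≤ i → i ≤ N → ∃ c : ℝ, ∀ p ∈ Set.Ioo (y (2 * i - 1)) (y (2 * i)),
      Tendsto (fun z => (f z).im) (𝓝[UHP] (p : ℂ)) (𝓝 c))
    (h4 : ∀ p ∈ Set.Ioo (y (2 * N - 1)) (y (2 * N)) ∪ Set.Ioo (y 1) t ∪ Set.Ioo s (y 2),
      Tendsto (fun z => (f z).im) (𝓝[UHP] (p : ℂ)) (𝓝 0))
    (h4' : ∀ p ∈ Set.Ioo t s, Tendsto (fun z => (f z).im) (𝓝[UHP] (p : ℂ)) (𝓝 0))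
    (h5 : ∀ z ∈ UHP, |(f z).im| ≤ C)
    (hw : ContinuousOn w (closure UHP \ {(t : ℂ), (s : ℂ)}))
    (hwf : ∀ z ∈ UHP, w z = (f z).im) : ∀ z ∈ UHP, f z = 0 := by
  obtain ⟨H, hH⟩ := family_exists (N := N) hy
  have hle : ∀ i, 1 ≤ i → i ≤ 2 * N - 1 → y 2 ≤ y (i + 1) := by
    intro i hi hi'
    rcases hi.eq_or_lt with h | h
    · rw [← h]
    · exact (hy 2 (i + 1) (by omega) (by omega) (by omega)).le
  -- values on the odd intervals
  have hb : ∀ i, 1 ≤ i → i ≤ N → ∀ x ∈ Icc (y (2 * i - 1)) (y (2 * i)), x ≠ t → x ≠ s →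
      w (x : ℂ) = w (y (2 * i) : ℂ) := by
    intro i hi hi' x hx hxt hxs
    have hab := hy (2 * i - 1) (2 * i) (by omega) (by omega) (by omega)
    have hyi : y 2 ≤ y (2 * i) := by
      have := hle (2 * i - 1) (by omega) (by omega)
      rwa [Nat.sub_add_cancel (by omega)] at this
    have hT : ∃ c, ∀ p ∈ Ioo (y (2 * i - 1)) (y (2 * i)), p ≠ t → p ≠ s →
        Tendsto (fun z => (f z).im) (𝓝[UHP] (p : ℂ)) (𝓝 c) := by
      rcases hi.eq_or_lt with h | h
      · subst h
        refine ⟨0, fun p hp hpt hps => ?_⟩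
        norm_num at hp
        rcases lt_or_gt_of_ne hpt with a | a
        · exact h4 p (Or.inl (Or.inr ⟨hp.1, a⟩))
        · rcases lt_or_gt_of_ne hps with b | b
          · exact h4' p ⟨a, b⟩
          · exact h4 p (Or.inr ⟨b, hp.2⟩)
      · obtain ⟨c, hc⟩ := h3 i h hi'
        exact ⟨c, fun p hp _ _ => hc p hp⟩
    obtain ⟨c, hc⟩ := hT
    have hv : ∀ u ∈ Ioo (y (2 * i - 1)) (y (2 * i)), u ≠ t → u ≠ s → w (u : ℂ) = c :=
      fun u hu a b => bd_lim hw hwf a b (hc u hu a b)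
    rw [bd_val hw hab hx hxt hxs hv, bd_val hw hab ⟨hab.le, le_rfl⟩ (by linarith [hyi] |> fun
      (a : t < y (2 * i)) => a.ne') (by linarith |> fun (a : s < y (2 * i)) => a.ne') hv]
  have hb1 : w (y 2 : ℂ) = 0 := by
    refine bd_val hw hs ⟨hs.le, le_rfl⟩ (hts.trans hs).ne' hs.ne' (fun u hu a b => ?_)
    exact bd_lim hw hwf a b (h4 u (Or.inr hu))
  have hbN : w (y (2 * N) : ℂ) = 0 := by
    have hab := hy (2 * N - 1) (2 * N) (by omega) (by omega) (by omega)
    have hyi := hy 2 (2 * N) (by omega) (by omega) (by omega)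
    refine bd_val hw hab ⟨hab.le, le_rfl⟩ (by linarith |> fun
      (a : t < y (2 * N)) => a.ne') (by linarith |> fun (a : s < y (2 * N)) => a.ne')
      (fun u hu a b => ?_)
    exact bd_lim hw hwf a b (h4 u (Or.inl (Or.inl hu)))
  -- even intervals
  have hev : ∀ k, Even k → ∃ c : ℝ, ∀ x : ℝ, InJ (2 * N) y k x →
      Tendsto (fun z => (f z).re) (𝓝[UHP] (x : ℂ)) (𝓝 c) := by
    intro k hk
    obtain ⟨i, hi⟩ := hk
    rcases Nat.eq_zero_or_pos i with h0 | h0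
    · refine ⟨0, fun x hx => h1 x (Or.inl ?_)⟩
      exact hx.2.2 1 (by omega) (by omega)
    · rcases lt_trichotomy i N with h | h | h
      · refine ⟨c, fun x hx => h2 i h0 (by omega) x ⟨?_, ?_⟩⟩
        · exact hx.2.1 _ (by omega) (by omega)
        · exact hx.2.2 _ (by omega) (by omega)
      · refine ⟨0, fun x hx => h1 x (Or.inr ?_)⟩
        exact hx.2.1 _ (by omega) (by omega)
      · refine ⟨0, fun x hx => ?_⟩
        have := hx.1
        omega
  obtain ⟨v, hv⟩ := EE_surj1 hH hN hy ht hts hs (fun i => w (y (2 * i) : ℂ))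
  have hn := EE_nice hH v t s
  have hed : DifferentiableOn ℂ (EE H v) UHP :=
    fun z hz => (hn.der z hz).differentiableAt.differentiableWithinAt
  obtain ⟨M, hM⟩ := hn.bdd
  have hec : ContinuousOn (fun z => (EE H v z).im) (closure UHP \ {(t : ℂ), (s : ℂ)}) :=
    Complex.continuous_im.comp_continuousOn hn.cont
  have hev' : ∀ k p, InJ (2 * N) y k p → Even k → ∃ r > 0, ∃ c : ℝ, ∀ x : ℝ, |x - p| < r →
      Tendsto (fun z => (f z - EE H v z).re) (𝓝[UHP] (x : ℂ)) (𝓝 c) := by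
    intro k p hp hk
    obtain ⟨r, hr, c1, hc1⟩ := hn.loc hN hy ht hts hs hp hk
    obtain ⟨r', hr', hr2⟩ := InJ_open hp
    obtain ⟨c2, hc2⟩ := hev k hk
    refine ⟨min r r', lt_min hr hr', c2 - c1, fun x hx => ?_⟩
    simp only [Complex.sub_re]
    exact (hc2 x (hr2 x (hx.le.trans (min_le_right _ _)))).sub
      (hc1 x (hx.trans_le (min_le_left _ _)))
  have hodd : ∀ i, 1 ≤ i → i ≤ N → ∀ x ∈ Icc (y (2 * i - 1)) (y (2 * i)), x ≠ t → x ≠ s →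
      w (x : ℂ) - (EE H v x).im = 0 := by
    intro i hi hi' x hx a b
    rw [hb i hi hi' x hx a b, EE_int hH hy v hi hi' x hx, hv i hi hi', sub_self]
  have m1 : ∀ z ∈ UHP, w z - (EE H v z).im ≤ 0 := by
    refine maxp (f := fun z => f z - EE H v z) (v := fun z => w z - (EE H v z).im)
      (M := C + M) hN hy ht hts (hd.sub hed) (fun z hz => ?_) (hw.sub hec) (fun z hz => ?_)
      (fun i hi hi' x hx a b => (hodd i hi hi' x hx a b).le) hev'
    · simp only [Complex.sub_im, hwf z hz]
    · have a1 := abs_le.1 (h5 z hz)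
      have a2 := abs_le.1 (hM z hz)
      simp only [hwf z hz]
      linarith [a1.2, a2.1]
  have m2 : ∀ z ∈ UHP, (EE H v z).im - w z ≤ 0 := by
    refine maxp (f := fun z => EE H v z - f z) (v := fun z => (EE H v z).im - w z)
      (M := C + M) hN hy ht hts (hed.sub hd) (fun z hz => ?_) (hec.sub hw) (fun z hz => ?_)
      (fun i hi hi' x hx a b => ?_) ?_
    · simp only [Complex.sub_im, hwf z hz]
    · have a1 := abs_le.1 (h5 z hz)
      have a2 := abs_le.1 (hM z hz)
      simp only [hwf z hz]
      linarith [a1.1, a2.2]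
    · have := hodd i hi hi' x hx a b
      show (EE H v x).im - w x ≤ 0
      linarith
    · intro k p hp hk
      obtain ⟨r, hr, c, hc⟩ := hev' k p hp hk
      refine ⟨r, hr, -c, fun x hx => ?_⟩
      refine (hc x hx).neg.congr (fun z => ?_)
      simp only [Complex.sub_re]
      ring
  have him : ∀ z ∈ UHP, (f z - EE H v z).im = 0 := by
    intro z hz
    have a1 := m1 z hz
    have a2 := m2 z hz
    rw [hwf z hz] at a1 a2
    rw [Complex.sub_im]
    linarith
  have hdd : DifferentiableOn ℂ (fun z => f z - EE H v z) UHP := hd.sub hed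
  have hI : I ∈ UHP := by simp [UHP]
  have hcst : ∀ z ∈ UHP, f z - EE H v z = f I - EE H v I := by
    intro z hz
    refine isOpen_UHP.is_const_of_deriv_eq_zero convex_UHP.isPreconnected hdd ?_ hz hI
    intro u hu
    exact deriv_zero_of_im him hu (hdd.differentiableAt (isOpen_UHP.mem_nhds hu)).hasDerivAt
  have hre : (f I - EE H v I).re = 0 := by
    have hp : y 1 - 1 < y 1 := by linarith
    have l1 := h1 (y 1 - 1) (Or.inl hp)
    have l2 := hn.tendsto_re (x := y 1 - 1) (by linarith |> fun (a : y 1 - 1 < t) => a.ne)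
      (by linarith |> fun (a : y 1 - 1 < s) => a.ne)
    rw [hn.left_zero hy ht hts hp.le] at l2
    have l3 := l1.sub l2
    have l4 : Tendsto (fun z => (f z).re - (EE H v z).re) (𝓝[UHP] ((y 1 - 1 : ℝ) : ℂ))
        (𝓝 (f I - EE H v I).re) := by
      refine tendsto_const_nhds.congr' ?_
      filter_upwards [self_mem_nhdsWithin] with z hz
      rw [← hcst z hz, Complex.sub_re]
    rw [sub_zero] at l3
    exact tendsto_nhds_unique l4 l3
  have hfe : ∀ z ∈ UHP, f z = EE H v z := by
    intro z hz
    have := hcst z hz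
    rw [Complex.ext (w := 0) hre (him I hI)] at this
    exact sub_eq_zero.1 this
  have hgap : ∀ i, 1 ≤ i → i ≤ N - 1 → (EE H v (y (2 * i))).re = c := by
    intro i hi hi'
    have hab := hy (2 * i) (2 * i + 1) (by omega) (by omega) (by omega)
    obtain ⟨p, hp⟩ := exists_between hab
    have hyi : y 2 ≤ y (2 * i) := by
      have := hle (2 * i - 1) (by omega) (by omega)
      rwa [Nat.sub_add_cancel (by omega)] at this
    rw [← hn.gap hy hts hs hi hi' p ⟨hp.1.le, hp.2.le⟩]
    have l2 := hn.tendsto_re (x := p) (by linarith [hp.1] |> fun (a : t < p) => a.ne')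
      (by linarith [hp.1] |> fun (a : s < p) => a.ne')
    refine tendsto_nhds_unique l2 ((h2 i hi hi' p hp).congr' ?_)
    filter_upwards [self_mem_nhdsWithin] with z hz
    rw [hfe z hz]
  have hv0 : v = 0 := by
    apply EE_inj2 hH hN hy ht hts hs v
    · have := hv 1 le_rfl (by omega)
      rw [mul_one] at this
      rw [this, hb1]
    · rw [hv N (by omega) le_rfl, hbN]
    · intro i hi hi'
      rw [hgap i (by omega) hi', ← hgap (i - 1) (by omega) (by omega)]
      have e : 2 * i - 1 = 2 * (i - 1) + 1 := by omega
      rw [e]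
      refine (hn.gap hy hts hs (by omega) (by omega) _ ⟨?_, le_rfl⟩).symm
      exact (hy _ _ (by omega) (by omega) (by omega)).le
  intro z hz
  rw [hfe z hz, hv0]
  simp [EE]

lemma bvp_unique {N : ℕ} (hN : 2 ≤ N) {y : ℕ → ℝ}
    (hy : ∀ i j : ℕ, 1 ≤ i → i < j → j ≤ 2 * N → y i < y j)
    {t s : ℝ} (ht : y 1 < t) (hts : t < s) (hs : s < y 2) {h k : ℂ → ℂ}
    (hh : SolvesBVP' N y t s h) (hk : SolvesBVP' N y t s k) : Set.EqOn h k UHP := by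
  obtain ⟨a0, a1, ⟨c, a2⟩, a3, a4, a5, ⟨C, a6⟩, g, a7, a8⟩ := hh
  obtain ⟨b0, b1, ⟨d, b2⟩, b3, b4, b5, ⟨D, b6⟩, e, b7, b8⟩ := hk
  have key := diff_zero hN hy ht hts hs (f := fun z => h z - k z) (w := fun z => g z - e z)
    (C := C + D) (c := c - d) (a0.sub b0) ?_ ?_ ?_ ?_ ?_ ?_ (a7.sub b7) ?_
  · intro z hz
    exact sub_eq_zero.1 (key z hz)
  · intro p hp
    simpa using (a1 p hp).sub (b1 p hp)
  · intro i hi hi' p hp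
    simpa using (a2 i hi hi' p hp).sub (b2 i hi hi' p hp)
  · intro i hi hi'
    obtain ⟨u, hu⟩ := a3 i hi hi'
    obtain ⟨v, hv⟩ := b3 i hi hi'
    refine ⟨u - v, fun p hp => ?_⟩
    simpa using (hu p hp).sub (hv p hp)
  · intro p hp
    simpa using (a4 p hp).sub (b4 p hp)
  · intro p hp
    simpa using (a5 p hp).sub (b5 p hp)
  · intro z hz
    rw [Complex.sub_im]
    exact (abs_sub _ _).trans (add_le_add (a6 z hz) (b6 z hz))
  · intro z hz
    simp only [a8 z hz, b8 z hz, Complex.sub_im]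

lemma bvp_exists {N : ℕ} (hN : 2 ≤ N) {y : ℕ → ℝ}
    (hy : ∀ i j : ℕ, 1 ≤ i → i < j → j ≤ 2 * N → y i < y j)
    {t s : ℝ} (ht : y 1 < t) (hts : t < s) (hs : s < y 2) :
    ∃ h : ℂ → ℂ, SolvesBVP' N y t s h := by
  obtain ⟨H, hH⟩ := family_exists (N := N) hy
  obtain ⟨h0, χ, hn0, hI1, hI2⟩ := h0_exists hN hy ht hts hs
  obtain ⟨v, hA, hB, hC⟩ := EE_surj2 hH hN hy ht hts hs (-(h0 (y 2)).im) (-(h0 (y (2 * N))).im)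
    (fun i => -((h0 (y (2 * i))).re - (h0 (y (2 * i - 1))).re))
  have hnE := EE_nice hH v t s
  have hn := hn0.add hnE
  set h : ℂ → ℂ := fun z => h0 z + EE H v z with hh
  have h12 := hy 1 2 le_rfl (by omega) (by omega)
  have h2N := hy 2 (2 * N) (by omega) (by omega) (by omega)
  have hle : ∀ i, 2 ≤ i → i ≤ 2 * N → y 2 ≤ y i := by
    intro i hi hi'
    rcases hi.eq_or_lt with h | h
    · rw [← h]
    · exact (hy 2 i (by omega) (by omega) (by omega)).le
  have hres : ∀ i, 1 ≤ i → i ≤ N - 1 → (h (y (2 * i))).re = (h (y 2)).re := by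
    intro i hi
    induction i, hi using Nat.le_induction with
    | base => intro _; rw [mul_one]
    | succ i hi ih =>
      intro hi'
      rw [← ih (by omega)]
      have a1 := hn.gap hy hts hs hi (by omega) (y (2 * i + 1))
        ⟨(hy _ _ (by omega) (by omega) (by omega)).le, le_rfl⟩
      have a2 := hC (i + 1) (by omega) hi'
      have e : 2 * (i + 1) - 1 = 2 * i + 1 := by omega
      rw [e] at a2
      rw [← a1]
      simp only [hh, Complex.add_re]
      linarith
  have hT : ∀ i, 2 ≤ i → i ≤ N → ∀ p ∈ Icc (y (2 * i - 1)) (y (2 * i)), p ≠ t ∧ p ≠ s := by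
    intro i hi hi' p hp
    have := hle (2 * i - 1) (by omega) (by omega)
    have a : s < p := by linarith [hp.1]
    exact ⟨(hts.trans a).ne', a.ne'⟩
  have hE1 : ∀ x ∈ Icc (y 1) (y 2), (EE H v x).im = -(h0 (y 2)).im := by
    intro x hx
    have := EE_int hH hy v (i := 1) le_rfl (by omega) x (by norm_num; exact hx)
    rw [this, mul_one, hA]
  refine ⟨h, fun z hz => (hn.der z hz).differentiableAt.differentiableWithinAt, ?_,
    ⟨(h (y 2)).re, ?_⟩, ?_, ?_, ?_, hn.bdd, fun z => (h z).im,
    Complex.continuous_im.comp_continuousOn hn.cont, fun z _ => rfl⟩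
  · rintro p (hp | hp)
    · have l := hn.tendsto_re (x := p) (hp.trans ht).ne (hp.trans (ht.trans hts)).ne
      rwa [hn.left_zero hy ht hts hp.le] at l
    · have a : s < p := by linarith
      have l := hn.tendsto_re (x := p) (hts.trans a).ne' a.ne'
      rwa [hn.right_zero hN hy hts hs hp.le] at l
  · intro i hi hi' p hp
    have := hle (2 * i) (by omega) (by omega)
    have a : s < p := by linarith [hp.1]
    have l := hn.tendsto_re (x := p) (hts.trans a).ne' a.ne'
    rwa [hn.gap hy hts hs hi hi' p ⟨hp.1.le, hp.2.le⟩, hres i hi hi'] at l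
  · intro i hi hi'
    refine ⟨(h (y (2 * i))).im, fun p hp => ?_⟩
    have hp' := Ioo_subset_Icc_self hp
    have a := hT i hi hi' p hp'
    have l := hn.tendsto_im a.1 a.2
    rwa [hn.int hy (by omega) hi' (hT i hi hi') p hp'] at l
  · rintro p ((hp | hp) | hp)
    · have hp' := Ioo_subset_Icc_self hp
      have a := hT N hN le_rfl p hp'
      have l := hn.tendsto_im a.1 a.2
      have z : (h (y (2 * N))).im = 0 := by
        simp only [hh, Complex.add_im, hB]
        ring
      rwa [hn.int hy (by omega) le_rfl (hT N hN le_rfl) p hp', z] at l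
    · have hp' : p ∈ Icc (y 1) (y 2) := ⟨hp.1.le, by linarith [hp.2]⟩
      have l := hn.tendsto_im (x := p) hp.2.ne (hp.2.trans hts).ne
      have z : (h p).im = 0 := by
        simp only [hh, Complex.add_im]
        rw [hI1 p hp' (Or.inl hp.2), hE1 p hp']
        ring
      rwa [z] at l
    · have hp' : p ∈ Icc (y 1) (y 2) := ⟨by linarith [hp.1], hp.2.le⟩
      have l := hn.tendsto_im (x := p) (hts.trans hp.1).ne' hp.1.ne'
      have z : (h p).im = 0 := by
        simp only [hh, Complex.add_im]
        rw [hI1 p hp' (Or.inr hp.1), hE1 p hp']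
        ring
      rwa [z] at l
  · intro p hp
    have hp' : p ∈ Icc (y 1) (y 2) := ⟨by linarith [hp.1], by linarith [hp.2]⟩
    have l := hn.tendsto_im (x := p) hp.1.ne' hp.2.ne
    have z : (h p).im = 1 := by
      simp only [hh, Complex.add_im]
      rw [hI2 p hp, hE1 p hp']
      ring
    rwa [z] at l

/-- Existence and uniqueness of the holomorphic observable solving the mixed boundary-value
problem with Dirichlet-1 window `(t,s) ⊂ (y₁, y₂)`. -/
theorem bvp'_exists_unique (N : ℕ) (hN : 2 ≤ N) (y : ℕ → ℝ)
    (hy : ∀ i j : ℕ, 1 ≤ i → i < j → j ≤ 2 * N → y i < y j)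
    (t s : ℝ) (ht : y 1 < t) (hts : t < s) (hs : s < y 2) :
    (∃ h : ℂ → ℂ, SolvesBVP' N y t s h) ∧
    (∀ h k : ℂ → ℂ, SolvesBVP' N y t s h → SolvesBVP' N y t s k →
      Set.EqOn h k UHP) := by
  exact ⟨bvp_exists hN hy ht hts hs, fun _ _ h k => bvp_unique hN hy ht hts hs h k⟩
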